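/- arXiv:2211.13567 — 9 statements merged into one kernel-verified Lean document; each statement's English description precedes it below -/
import Mathlib

section
/- Let k, m, n be positive integers. If there is no party-approval rule for n voters, m parties, and committee size k satisfying anonymity, weak representation, and strategyproofness, then for every positive integer ℓ there is no party-approval rule for ℓ·n voters, m parties, and committee size k satisfying anonymity, weak representation, and strategyproofness. -/
/-- An approval profile is valid if every voter's ballot is nonempty. -/
def ValidProfile {P : Type*} (n : ℕ) (A : Fin n → Finset P) : Prop :=
  ∀ i, (A i).Nonempty

/-- The number of seats a committee `W` assigns to the parties in `X`. -/
def seats {P : Type*} [DecidableEq P] (W : Multiset P) (X : Finset P) : ℕ :=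
  ∑ x ∈ X, W.count x

/-- A party-approval rule for `n` voters and committee size `k`:
it assigns to every (valid) approval profile a committee of size `k`. -/
def IsPAPPRule {P : Type*} (n k : ℕ) (f : (Fin n → Finset P) → Multiset P) : Prop :=
  ∀ A, ValidProfile n A → Multiset.card (f A) = k

/-- Anonymity: permuting the voters does not change the outcome. -/
def Anonymous {P : Type*} (n : ℕ) (f : (Fin n → Finset P) → Multiset P) : Prop :=
  ∀ A, ValidProfile n A → ∀ π : Equiv.Perm (Fin n), f (fun i => A (π i)) = f A

/-- Weak representation: a party uniquely approved by at least `n / k` voters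
gets at least one seat. -/
def WeakRep {P : Type*} [DecidableEq P] (n k : ℕ)
    (f : (Fin n → Finset P) → Multiset P) : Prop :=
  ∀ A, ValidProfile n A → ∀ (x : P) (G : Finset (Fin n)),
    n ≤ k * G.card → (∀ i ∈ G, A i = {x}) → 1 ≤ (f A).count x

/-- Weak proportional representation: a party uniquely approved by at least
`ℓ * n / k` voters gets at least `ℓ` seats. -/
def WeakPropRep {P : Type*} [DecidableEq P] (n k : ℕ)
    (f : (Fin n → Finset P) → Multiset P) : Prop :=
  ∀ A, ValidProfile n A → ∀ (x : P) (G : Finset (Fin n)) (ℓ : ℕ),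
    1 ≤ ℓ → ℓ * n ≤ k * G.card → (∀ i ∈ G, A i = {x}) → ℓ ≤ (f A).count x

/-- Strategyproofness: no voter can increase the number of seats assigned to
her approved parties by misreporting her ballot. -/
def Strategyproof {P : Type*} [DecidableEq P] (n : ℕ)
    (f : (Fin n → Finset P) → Multiset P) : Prop :=
  ∀ A A' : Fin n → Finset P, ValidProfile n A → ValidProfile n A' →
    ∀ i : Fin n, (∀ j, j ≠ i → A j = A' j) →
      seats (f A') (A i) ≤ seats (f A) (A i)

/-- A group of voters sharing the same ballot `X` cannot gain seats for `X` by jointly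
misreporting under a strategyproof rule. -/
theorem Strategyproof.seats_le_of_group {P : Type*} [DecidableEq P] {N : ℕ}
    {f : (Fin N → Finset P) → Multiset P} (hf : Strategyproof N f) {X : Finset P}
    {B : Fin N → Finset P} (hB : ValidProfile N B) (S : Finset (Fin N))
    (hS : ∀ j ∈ S, B j = X) (B' : Fin N → Finset P) (hB' : ValidProfile N B')
    (h : ∀ j, j ∉ S → B j = B' j) : seats (f B') X ≤ seats (f B) X := by
  induction S using Finset.induction_on generalizing B' with
  | empty =>
    have hBB' : B = B' := funext fun j => h j (Finset.notMem_empty j)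
    rw [hBB']
  | insert a S _ ih =>
    have hX : B a = X := hS a (Finset.mem_insert_self a S)
    have hv : ValidProfile N (Function.update B' a X) := by
      intro j
      rcases eq_or_ne j a with rfl | hj
      · simpa [← hX] using hB j
      · simpa [hj] using hB' j
    have hle : seats (f (Function.update B' a X)) X ≤ seats (f B) X := by
      refine ih (fun j hj => hS j (Finset.mem_insert_of_mem hj)) _ hv fun j hj => ?_
      rcases eq_or_ne j a with rfl | hja
      · simpa using hX
      · simpa [hja] using h j (by simp [hja, hj])
    have hstep := hf (Function.update B' a X) B' hv hB' a fun j hj => by simp [hj]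
    rw [Function.update_self] at hstep
    exact hstep.trans hle

/-- The voter in the original electorate of which `i` is a copy. -/
def originalVoter {ℓ n : ℕ} (i : Fin (ℓ * n)) : Fin n := (finProdFinEquiv.symm i).2

/-- The profile in which every voter of `A` is replaced by `ℓ` copies. -/
def replicateProfile {P : Type*} (ℓ : ℕ) {n : ℕ} (A : Fin n → Finset P) :
    Fin (ℓ * n) → Finset P := fun i => A (originalVoter i)

theorem ValidProfile.replicateProfile {P : Type*} {n : ℕ} {A : Fin n → Finset P}
    (hA : ValidProfile n A) (ℓ : ℕ) : ValidProfile (ℓ * n) (replicateProfile ℓ A) :=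
  fun i => hA (originalVoter i)

theorem card_filter_originalVoter_mem {n : ℕ} (ℓ : ℕ) (G : Finset (Fin n)) :
    (Finset.univ.filter fun i : Fin (ℓ * n) => originalVoter i ∈ G).card = ℓ * G.card := by
  have hG : (Finset.univ.filter fun i : Fin (ℓ * n) => originalVoter i ∈ G) =
      ((Finset.univ : Finset (Fin ℓ)) ×ˢ G).map finProdFinEquiv.toEmbedding := by
    ext i
    rw [Finset.mem_filter]
    simp [originalVoter, Finset.mem_map_equiv, -finProdFinEquiv_symm_apply]
  rw [hG, Finset.card_map, Finset.card_product, Finset.card_univ, Fintype.card_fin]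

theorem Anonymous.comp_replicateProfile {P : Type*} {ℓ n : ℕ}
    {f : (Fin (ℓ * n) → Finset P) → Multiset P} (hf : Anonymous (ℓ * n) f) :
    Anonymous n fun A => f (replicateProfile ℓ A) := by
  intro A hA π
  beta_reduce
  rw [← hf _ (hA.replicateProfile ℓ)
    (finProdFinEquiv.permCongr ((Equiv.refl (Fin ℓ)).prodCongr π))]
  congr 1
  funext i
  simp [replicateProfile, originalVoter, Equiv.permCongr_apply, -finProdFinEquiv_symm_apply]

theorem WeakRep.comp_replicateProfile {P : Type*} [DecidableEq P] {ℓ n k : ℕ}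
    {f : (Fin (ℓ * n) → Finset P) → Multiset P} (hf : WeakRep (ℓ * n) k f) :
    WeakRep n k fun A => f (replicateProfile ℓ A) := by
  intro A hA x G hG hx
  refine hf _ (hA.replicateProfile ℓ) x
    (Finset.univ.filter fun i => originalVoter i ∈ G) ?_ fun i hi => ?_
  · rw [card_filter_originalVoter_mem, Nat.mul_left_comm]
    exact Nat.mul_le_mul_left ℓ hG
  · exact hx _ (Finset.mem_filter.mp hi).2

theorem Strategyproof.comp_replicateProfile {P : Type*} [DecidableEq P] {ℓ n : ℕ}
    {f : (Fin (ℓ * n) → Finset P) → Multiset P} (hf : Strategyproof (ℓ * n) f) :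
    Strategyproof n fun A => f (replicateProfile ℓ A) := by
  intro A A' hA hA' i h
  refine hf.seats_le_of_group (hA.replicateProfile ℓ)
    (Finset.univ.filter fun j => originalVoter j = i) (fun j hj => ?_) _
    (hA'.replicateProfile ℓ) fun j hj => ?_
  · exact congrArg A (Finset.mem_filter.mp hj).2
  · exact h _ fun hji => hj (by simp [hji])

/-- If there is no anonymous, weakly representative, strategyproof
party-approval rule for `n` voters, `m` parties, and committee size `k`, then for every
`ℓ ≥ 1` there is no such rule for `ℓ·n` voters, `m` parties, and committee size `k`. -/
theorem papp_impossibility_voter_multiplication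
    (k m n : ℕ) (hk : 1 ≤ k) (hm : 1 ≤ m) (hn : 1 ≤ n)
    (h : ¬ ∃ f : (Fin n → Finset (Fin m)) → Multiset (Fin m),
        IsPAPPRule n k f ∧ Anonymous n f ∧ WeakRep n k f ∧ Strategyproof n f)
    (ℓ : ℕ) (hℓ : 1 ≤ ℓ) :
    ¬ ∃ f : (Fin (ℓ * n) → Finset (Fin m)) → Multiset (Fin m),
        IsPAPPRule (ℓ * n) k f ∧ Anonymous (ℓ * n) f ∧ WeakRep (ℓ * n) k f ∧
          Strategyproof (ℓ * n) f := by
  rintro ⟨f, hcard, hanon, hrep, hsp⟩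
  exact h ⟨fun A => f (replicateProfile ℓ A), fun A hA => hcard _ (hA.replicateProfile ℓ),
    hanon.comp_replicateProfile, hrep.comp_replicateProfile, hsp.comp_replicateProfile⟩
end

section
/- Let k, m, n be positive integers. If there is no party-approval rule for n voters, m parties, and committee size k satisfying anonymity, weak representation, and strategyproofness, then there is no party-approval rule for n voters, m+1 parties, and committee size k satisfying anonymity, weak representation, and strategyproofness. -/
/-- The number of seats of `X` as a count of committee members lying in `X`. -/
theorem seats_eq_countP {P : Type*} [DecidableEq P] (W : Multiset P) (X : Finset P) :
    seats W X = W.countP (· ∈ X) := by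
  induction W using Multiset.induction_on with
  | empty => simp [seats]
  | cons a W ih =>
    rw [Multiset.countP_cons, ← ih]
    simp [seats, Multiset.count_cons, Finset.sum_add_distrib]

/-- Merging parties along `φ` adds up the seats of the merged parties. -/
theorem seats_map {Q P : Type*} [Fintype Q] [DecidableEq Q] [DecidableEq P] (φ : Q → P)
    (W : Multiset Q) (X : Finset P) :
    seats (W.map φ) X = seats W {q | φ q ∈ X} := by
  simp [seats_eq_countP, Multiset.countP_eq_card_filter, Multiset.filter_map]

/-- Under a strategyproof rule, if voters with common ballot `S` switch to another ballot,
the number of seats of `S` does not increase. -/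
theorem Strategyproof.seats_group_le {P : Type*} [DecidableEq P] {n : ℕ}
    {f : (Fin n → Finset P) → Multiset P} (hf : Strategyproof n f)
    {A : Fin n → Finset P} (hA : ValidProfile n A) {S T : Finset P} (hT : T.Nonempty)
    (G : Finset (Fin n)) (hG : ∀ i ∈ G, A i = S) :
    seats (f fun i => if i ∈ G then T else A i) S ≤ seats (f A) S := by
  induction G using Finset.induction_on with
  | empty => simp
  | insert a G ha ih =>
    have valid : ∀ H : Finset (Fin n), ValidProfile n fun i => if i ∈ H then T else A i := by
      intro H i
      dsimp only
      split_ifs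
      · exact hT
      · exact hA i
    refine le_trans ?_ (ih fun i hi => hG i (Finset.mem_insert_of_mem hi))
    have key := hf _ _ (valid G) (valid (insert a G)) a fun j hj => by
      simp [Finset.mem_insert, hj]
    simpa only [ha, if_false, hG a (Finset.mem_insert_self a G)] using key

/-- Under a strategyproof and weakly representative rule, a group of at least `n / k` voters
with the same ballot gets at least one seat. -/
theorem Strategyproof.one_le_seats {P : Type*} [DecidableEq P] {n k : ℕ}
    {f : (Fin n → Finset P) → Multiset P} (hf : Strategyproof n f) (hw : WeakRep n k f)
    {A : Fin n → Finset P} (hA : ValidProfile n A) {S : Finset P} (hS : S.Nonempty)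
    {G : Finset (Fin n)} (hcard : n ≤ k * G.card) (hG : ∀ i ∈ G, A i = S) :
    1 ≤ seats (f A) S := by
  obtain ⟨y, hy⟩ := hS
  refine le_trans ?_ (hf.seats_group_le hA (Finset.singleton_nonempty y) G hG)
  refine le_trans (hw _ (fun i => ?_) y G hcard fun i hi => if_pos hi)
    (Finset.single_le_sum (f := fun x => Multiset.count x _) (fun _ _ => Nat.zero_le _) hy)
  split_ifs
  · exact Finset.singleton_nonempty y
  · exact hA i

/-- A rule with the three axioms can be transported along any surjection of parties: pull the
ballots back, apply the rule, and merge the parties of the resulting committee. -/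
theorem exists_rule_of_surjective {Q P : Type*} [Fintype Q] [DecidableEq Q] [DecidableEq P]
    {φ : Q → P} (hφ : Function.Surjective φ) {n k : ℕ}
    {f : (Fin n → Finset Q) → Multiset Q} (hr : IsPAPPRule n k f) (ha : Anonymous n f)
    (hw : WeakRep n k f) (hs : Strategyproof n f) :
    ∃ g : (Fin n → Finset P) → Multiset P,
      IsPAPPRule n k g ∧ Anonymous n g ∧ WeakRep n k g ∧ Strategyproof n g := by
  have nonempty_pullback : ∀ X : Finset P, X.Nonempty →
      (Finset.univ.filter fun q => φ q ∈ X).Nonempty := by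
    rintro X ⟨x, hx⟩
    obtain ⟨q, rfl⟩ := hφ x
    exact ⟨q, by simpa using hx⟩
  have valid : ∀ A : Fin n → Finset P, ValidProfile n A →
      ValidProfile n fun i => Finset.univ.filter fun q => φ q ∈ A i :=
    fun A hA i => nonempty_pullback _ (hA i)
  refine ⟨fun A => (f fun i => Finset.univ.filter fun q => φ q ∈ A i).map φ, ?_, ?_, ?_, ?_⟩
  · intro A hA
    rw [Multiset.card_map]
    exact hr _ (valid A hA)
  · intro A hA π
    exact congrArg (Multiset.map φ) (ha _ (valid A hA) π)
  · intro A hA x G hcard hG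
    have key := hs.one_le_seats hw (valid A hA)
      (nonempty_pullback {x} (Finset.singleton_nonempty x)) hcard
      fun i hi => by simp only [hG i hi]
    rw [← seats_map] at key
    simpa only [seats, Finset.sum_singleton] using key
  · intro A A' hA hA' i hi
    simp only [seats_map]
    exact hs _ _ (valid A hA) (valid A' hA') i fun j hj => by simp only [hi j hj]

/-- If there is no anonymous, weakly representative, strategyproof
party-approval rule for `n` voters, `m` parties, and committee size `k`, then there is
no such rule for `n` voters, `m+1` parties, and committee size `k`. -/
theorem papp_impossibility_add_party
    (k m n : ℕ) (hk : 1 ≤ k) (hm : 1 ≤ m) (hn : 1 ≤ n)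
    (h : ¬ ∃ f : (Fin n → Finset (Fin m)) → Multiset (Fin m),
        IsPAPPRule n k f ∧ Anonymous n f ∧ WeakRep n k f ∧ Strategyproof n f) :
    ¬ ∃ f : (Fin n → Finset (Fin (m + 1))) → Multiset (Fin (m + 1)),
        IsPAPPRule n k f ∧ Anonymous n f ∧ WeakRep n k f ∧ Strategyproof n f := by
  rintro ⟨f, hr, ha, hw, hs⟩
  have hφ : Function.Surjective
      (Fin.lastCases ⟨0, hm⟩ id : Fin (m + 1) → Fin m) :=
    fun x => ⟨x.castSucc, by simp⟩
  exact h (exists_rule_of_surjective hφ hr ha hw hs)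
end

section
/- Let k, m, n be positive integers such that k divides n. If there is no party-approval rule for n voters, m parties, and committee size k satisfying anonymity, weak proportional representation, and strategyproofness, then there is no party-approval rule for n(k+1)/k voters, m parties, and committee size k+1 satisfying anonymity, weak proportional representation, and strategyproofness. -/
/-- The profile `A` extended by `q` voters who approve only the party `x`. -/
def extendProfile {P : Type*} {n : ℕ} (q : ℕ) (x : P) (A : Fin n → Finset P) :
    Fin (n + q) → Finset P :=
  Fin.append A (fun _ => {x})

section Extend

variable {P : Type*} {n q k : ℕ} {x : P} {A : Fin n → Finset P}

@[simp]
lemma extendProfile_castAdd (i : Fin n) : extendProfile q x A (Fin.castAdd q i) = A i :=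
  Fin.append_left _ _ i

@[simp]
lemma extendProfile_natAdd (i : Fin q) : extendProfile q x A (Fin.natAdd n i) = {x} :=
  Fin.append_right _ _ i

lemma ValidProfile.extendProfile (hA : ValidProfile n A) :
    ValidProfile (n + q) (extendProfile q x A) := by
  intro i
  induction i using Fin.addCases with
  | left i => simpa using hA i
  | right i => simp

lemma extendProfile_comp_perm (π : Equiv.Perm (Fin n)) :
    extendProfile q x (fun i => A (π i)) =
      fun i => extendProfile q x A
        (finSumFinEquiv.permCongr (Equiv.sumCongr π (Equiv.refl (Fin q))) i) := by
  funext i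
  induction i using Fin.addCases with
  | left i => simp [Equiv.permCongr_apply]
  | right i => simp [Equiv.permCongr_apply]

variable [DecidableEq P]

lemma seats_erase_add {W : Multiset P} (hx : x ∈ W) (X : Finset P) :
    seats (W.erase x) X + (if x ∈ X then 1 else 0) = seats W X := by
  unfold seats
  rw [← Finset.sum_ite_eq' X x (fun _ => 1), ← Finset.sum_add_distrib]
  refine Finset.sum_congr rfl fun y _ => ?_
  conv_rhs => rw [← Multiset.cons_erase hx, Multiset.count_cons]

variable {f : (Fin (n + q) → Finset P) → Multiset P}

lemma WeakPropRep.mem_extendProfile (hn : n = k * q) (hf : WeakPropRep (n + q) (k + 1) f)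
    (hA : ValidProfile n A) : x ∈ f (extendProfile q x A) := by
  rw [← Multiset.one_le_count_iff_mem]
  refine hf _ hA.extendProfile x (Finset.univ.map (Fin.natAddEmb n)) 1 le_rfl ?_ (by simp)
  rw [Finset.card_map, Finset.card_univ, Fintype.card_fin, hn]
  linarith

lemma IsPAPPRule.erase_extendProfile (hn : n = k * q) (hf : IsPAPPRule (n + q) (k + 1) f)
    (hw : WeakPropRep (n + q) (k + 1) f) :
    IsPAPPRule n k (fun A => (f (extendProfile q x A)).erase x) := by
  intro A hA
  simp [Multiset.card_erase_of_mem (hw.mem_extendProfile hn hA), hf _ hA.extendProfile]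

lemma Anonymous.erase_extendProfile (hf : Anonymous (n + q) f) :
    Anonymous n (fun A => (f (extendProfile q x A)).erase x) := by
  intro A hA π
  dsimp only
  rw [extendProfile_comp_perm, hf _ hA.extendProfile]

lemma WeakPropRep.erase_extendProfile (hn : n = k * q) (hk : 0 < k)
    (hf : WeakPropRep (n + q) (k + 1) f) :
    WeakPropRep n k (fun A => (f (extendProfile q x A)).erase x) := by
  intro A hA y G l hl hG hGy
  have hlG : l * q ≤ G.card := by
    refine Nat.le_of_mul_le_mul_left ?_ hk
    calc k * (l * q) = l * n := by rw [hn]; ring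
      _ ≤ k * G.card := hG
  by_cases hyx : y = x
  · subst hyx
    have key := hf _ (hA.extendProfile (q := q) (x := y)) y
      ((G.disjSum Finset.univ).map finSumFinEquiv.toEmbedding) (l + 1) (by omega)
      (by
        rw [Finset.card_map, Finset.card_disjSum, Finset.card_univ, Fintype.card_fin]
        linarith)
      (by
        intro i hi
        obtain ⟨j, hj, rfl⟩ := Finset.mem_map.1 hi
        rcases j with j | j
        · simpa using hGy j (by simpa using hj)
        · simp)
    rw [Multiset.count_erase_self]
    omega
  · rw [Multiset.count_erase_of_ne hyx]
    refine hf _ hA.extendProfile y (G.map (Fin.castAddEmb q)) l hl ?_ ?_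
    · rw [Finset.card_map]
      linarith
    · intro i hi
      obtain ⟨j, hj, rfl⟩ := Finset.mem_map.1 hi
      simpa using hGy j hj

lemma Strategyproof.erase_extendProfile (hn : n = k * q) (hw : WeakPropRep (n + q) (k + 1) f)
    (hf : Strategyproof (n + q) f) :
    Strategyproof n (fun A => (f (extendProfile q x A)).erase x) := by
  intro A A' hA hA' i hAA'
  have key := hf (extendProfile q x A) (extendProfile q x A') hA.extendProfile
    hA'.extendProfile (Fin.castAdd q i) (by
      intro j hj
      induction j using Fin.addCases with
      | left j => simpa using hAA' j (by rintro rfl; exact hj rfl)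
      | right j => simp)
  rw [extendProfile_castAdd, ← seats_erase_add (hw.mem_extendProfile hn hA),
    ← seats_erase_add (hw.mem_extendProfile hn hA')] at key
  exact Nat.le_of_add_le_add_right key

end Extend

/-- Let `k ∣ n`. If there is no anonymous, strategyproof
party-approval rule satisfying weak proportional representation for `n` voters,
`m` parties, and committee size `k`, then there is no such rule for `n(k+1)/k` voters,
`m` parties, and committee size `k+1`. -/
theorem papp_impossibility_increase_committee_weakPropRep
    (k m n : ℕ) (hk : 1 ≤ k) (hm : 1 ≤ m) (hn : 1 ≤ n) (hdvd : k ∣ n)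
    (h : ¬ ∃ f : (Fin n → Finset (Fin m)) → Multiset (Fin m),
        IsPAPPRule n k f ∧ Anonymous n f ∧ WeakPropRep n k f ∧ Strategyproof n f) :
    ¬ ∃ f : (Fin (n * (k + 1) / k) → Finset (Fin m)) → Multiset (Fin m),
        IsPAPPRule (n * (k + 1) / k) (k + 1) f ∧ Anonymous (n * (k + 1) / k) f ∧
          WeakPropRep (n * (k + 1) / k) (k + 1) f ∧ Strategyproof (n * (k + 1) / k) f := by
  obtain ⟨q, hq⟩ := hdvd
  have hN : n * (k + 1) / k = n + q := by
    rw [hq, show k * q * (k + 1) = k * (k * q + q) by ring, Nat.mul_div_cancel_left _ hk]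
  rw [hN]
  rintro ⟨f, hf, ha, hw, hs⟩
  exact h ⟨fun A => (f (extendProfile q ⟨0, hm⟩ A)).erase ⟨0, hm⟩,
    hf.erase_extendProfile hq hw, ha.erase_extendProfile, hw.erase_extendProfile hq hk,
    hs.erase_extendProfile hq hw⟩
end

section
/- Let f be a party-approval rule for n voters, a set of parties 𝒫, and committee size k that satisfies strategyproofness and weak representation. Then for every approval profile A, every nonempty subset X ⊆ 𝒫, and every integer ℓ with 1 ≤ ℓ ≤ k and |X| ≥ ℓ: if at least ℓ·⌈n/k⌉ voters report X as their approval ballot in A, then f(A,X) ≥ ℓ. -/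
/-- If the voters in `S` all report `X` in `A`, then changing their ballots cannot increase the
number of seats going to `X`. -/
theorem Strategyproof.seats_le_of_forall_eq {P : Type*} [DecidableEq P] {n : ℕ}
    {f : (Fin n → Finset P) → Multiset P} (hsp : Strategyproof n f)
    {A : Fin n → Finset P} (hA : ValidProfile n A) {X : Finset P} (S : Finset (Fin n))
    (hS : ∀ i ∈ S, A i = X) (B : Fin n → Finset P) (hB : ValidProfile n B)
    (hBA : ∀ i ∉ S, B i = A i) :
    seats (f B) X ≤ seats (f A) X := by
  induction S using Finset.induction_on generalizing B with
  | empty => rw [funext fun i => hBA i (Finset.notMem_empty i)]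
  | insert a s ha ih =>
    have haX : A a = X := hS a (Finset.mem_insert_self a s)
    have hC : ValidProfile n (Function.update B a X) := by
      intro i
      by_cases h : i = a
      · subst h
        simpa [haX] using hA i
      · simpa [h] using hB i
    have hstep : seats (f B) X ≤ seats (f (Function.update B a X)) X := by
      have := hsp (Function.update B a X) B hC hB a
        (fun j hj => Function.update_of_ne hj _ _)
      rwa [Function.update_self] at this
    refine hstep.trans (ih (fun i hi => hS i (Finset.mem_insert_of_mem hi)) _ hC ?_)
    intro i hi
    by_cases h : i = a
    · subst h
      simp [haX]
    · simpa [h] using hBA i (by simp [h, hi])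

/-- A committee containing each of `ℓ` distinct parties of `X` gives `X` at least `ℓ` seats. -/
theorem le_seats_of_embedding {P : Type*} [DecidableEq P] {W : Multiset P} {X : Finset P}
    {ℓ : ℕ} (x : Fin ℓ ↪ X) (h : ∀ j, 1 ≤ W.count (x j : P)) : ℓ ≤ seats W X := by
  calc ℓ = ∑ _j : Fin ℓ, 1 := by simp
    _ ≤ ∑ j : Fin ℓ, W.count (x j : P) := Finset.sum_le_sum fun j _ => h j
    _ = ∑ y ∈ Finset.univ.map (x.trans (Function.Embedding.subtype _)), W.count y := by
      simp [Finset.sum_map]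
    _ ≤ seats W X := by
      refine Finset.sum_le_sum_of_subset fun y hy => ?_
      obtain ⟨j, -, rfl⟩ := Finset.mem_map.1 hy
      exact (x j).2

/-- If a party-approval rule satisfies strategyproofness and weak
representation, then whenever at least `ℓ·⌈n/k⌉` voters report the ballot `X`
(with `1 ≤ ℓ ≤ k` and `|X| ≥ ℓ`), at least `ℓ` seats go to parties in `X`. -/
theorem seats_of_common_ballot
    {P : Type*} [DecidableEq P] (n k : ℕ)
    (f : (Fin n → Finset P) → Multiset P)
    (hrule : IsPAPPRule n k f) (hsp : Strategyproof n f) (hwr : WeakRep n k f)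
    (A : Fin n → Finset P) (hA : ValidProfile n A)
    (X : Finset P) (hX : X.Nonempty)
    (ℓ : ℕ) (hℓ1 : 1 ≤ ℓ) (hℓk : ℓ ≤ k) (hℓX : ℓ ≤ X.card)
    (hcount : ℓ * ((n + k - 1) / k) ≤ (Finset.univ.filter fun i => A i = X).card) :
    ℓ ≤ seats (f A) X := by
  set q := (n + k - 1) / k with hq
  set S := Finset.univ.filter fun i => A i = X with hS
  have hnq : n ≤ k * q := by
    have h1 := Nat.div_add_mod (n + k - 1) k
    have h2 := Nat.mod_lt (n + k - 1) (show 0 < k by omega)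
    rw [← hq] at h1
    omega
  obtain ⟨x⟩ : Nonempty (Fin ℓ ↪ X) :=
    Function.Embedding.nonempty_of_card_le (by simpa using hℓX)
  obtain ⟨g⟩ : Nonempty (Fin ℓ × Fin q ↪ S) :=
    Function.Embedding.nonempty_of_card_le (by simpa using hcount)
  let e : Fin ℓ × Fin q ↪ Fin n := g.trans (Function.Embedding.subtype _)
  let B : Fin n → Finset P := Function.extend e (fun p => {(x p.1 : P)}) A
  have hBe (p : Fin ℓ × Fin q) : B (e p) = {(x p.1 : P)} := e.injective.extend_apply _ _ p
  have hB : ValidProfile n B := by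
    intro i
    by_cases h : ∃ p, e p = i
    · obtain ⟨p, rfl⟩ := h
      simp [hBe]
    · simpa [B, Function.extend_apply' _ _ _ h] using hA i
  refine (le_seats_of_embedding x fun j => ?_).trans
    (hsp.seats_le_of_forall_eq hA S (fun i hi => (Finset.mem_filter.1 hi).2) B hB fun i hi => ?_)
  · refine hwr B hB _ (Finset.univ.map ((Function.Embedding.sectR j (Fin q)).trans e))
      (by simpa using hnq) fun i hi => ?_
    obtain ⟨t, -, rfl⟩ := Finset.mem_map.1 hi
    exact hBe (j, t)
  · refine Function.extend_apply' _ _ _ ?_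
    rintro ⟨p, rfl⟩
    exact hi (g p).2
end

section
/- Let f be an anonymous party-approval rule for n voters, a set of parties 𝒫, and committee size k that satisfies strategyproofness and weak representation. Let A be an approval profile and let X = {x ∈ 𝒫 : there is a group of voters G with k·|G| ≥ n and A_i = {x} for all i ∈ G} be the set of parties each uniquely approved by at least n/k voters. If there exist pairwise distinct voters i_1, …, i_ℓ with k·ℓ ≥ n, A_{i_1} ⊆ A_{i_2} ⊆ ⋯ ⊆ A_{i_ℓ}, and A_{i_1} ⊄ X, then f(A, A_{i_ℓ}) ≥ |A_{i_ℓ} ∩ X| + 1. -/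
/-- If every party of `X` has a seat, then passing from `S` to a superset `T` adds at least
as many seats as it adds parties of `X`. -/
lemma seats_superset_of_forall_one_le_count {P : Type*} [DecidableEq P] {W : Multiset P}
    {S T X : Finset P} (hX : ∀ x ∈ X, 1 ≤ W.count x) (hST : S ⊆ T)
    (hS : (S ∩ X).card + 1 ≤ seats W S) : (T ∩ X).card + 1 ≤ seats W T := by
  have hsplit : seats W T = seats W (T \ S) + seats W S :=
    (Finset.sum_sdiff hST).symm
  have hdiff : ((T \ S) ∩ X).card ≤ seats W (T \ S) := by
    calc ((T \ S) ∩ X).card = ∑ x ∈ (T \ S) ∩ X, 1 := Finset.card_eq_sum_ones _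
      _ ≤ ∑ x ∈ (T \ S) ∩ X, W.count x :=
        Finset.sum_le_sum fun x hx => hX x (Finset.mem_inter.1 hx).2
      _ ≤ seats W (T \ S) := Finset.sum_le_sum_of_subset Finset.inter_subset_left
  have hcard : (T ∩ X).card ≤ ((T \ S) ∩ X).card + (S ∩ X).card := by
    have h := Finset.card_union_le ((T \ S) ∩ X) (S ∩ X)
    rwa [← Finset.union_inter_distrib_right, Finset.sdiff_union_of_subset hST] at h
  omega

open Classical in
/-- The profile obtained from `A` by letting the voters `v a` with `m ≤ a` approve only `x`. -/
noncomputable def tailReplaced {P : Type*} {n ℓ : ℕ} (A : Fin n → Finset P)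
    (v : Fin (ℓ + 1) → Fin n) (x : P) (m : ℕ) : Fin n → Finset P :=
  fun i => if ∃ a, m ≤ a.val ∧ v a = i then {x} else A i

section tailReplaced

variable {P : Type*} {n ℓ : ℕ} {A : Fin n → Finset P} {v : Fin (ℓ + 1) → Fin n} {x : P}

lemma tailReplaced_of_le {m : ℕ} {a : Fin (ℓ + 1)} (h : m ≤ a.val) :
    tailReplaced A v x m (v a) = {x} :=
  if_pos ⟨a, h, rfl⟩

lemma tailReplaced_of_forall_ne {m : ℕ} {i : Fin n} (h : ∀ a, m ≤ a.val → v a ≠ i) :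
    tailReplaced A v x m i = A i :=
  if_neg fun ⟨a, ha, hi⟩ => h a ha hi

lemma validProfile_tailReplaced (hA : ValidProfile n A) (m : ℕ) :
    ValidProfile n (tailReplaced A v x m) := by
  intro i
  unfold tailReplaced
  split_ifs
  · exact Finset.singleton_nonempty x
  · exact hA i

lemma tailReplaced_succ_self (hv : Function.Injective v) (a : Fin (ℓ + 1)) :
    tailReplaced A v x (a.val + 1) (v a) = A (v a) :=
  tailReplaced_of_forall_ne fun b hb h => by
    have := hv h
    subst this
    omega

lemma tailReplaced_succ_of_ne {a : Fin (ℓ + 1)} {j : Fin n} (hj : j ≠ v a) :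
    tailReplaced A v x (a.val + 1) j = tailReplaced A v x a.val j := by
  by_cases h : ∃ b : Fin (ℓ + 1), a.val ≤ b.val ∧ v b = j
  · obtain ⟨b, hb, rfl⟩ := h
    have hab : a.val ≠ b.val := fun h => hj (congrArg v (Fin.ext h)).symm
    rw [tailReplaced_of_le hb, tailReplaced_of_le (by omega)]
  · push Not at h
    rw [tailReplaced_of_forall_ne h, tailReplaced_of_forall_ne fun b hb => h b (by omega)]

lemma tailReplaced_last : tailReplaced A v x (ℓ + 1) = A :=
  funext fun _ => tailReplaced_of_forall_ne fun a ha => by omega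

end tailReplaced

/-- Let `f` be an anonymous, strategyproof party-approval rule
satisfying weak representation, let `A` be a profile, and let `X` be the set of
parties each uniquely approved by at least `n/k` voters. If there are pairwise
distinct voters `v 0, …, v (Fin.last ℓ)` (so `ℓ+1` many) with `k·(ℓ+1) ≥ n` whose
ballots form an inclusion chain and the smallest ballot is not contained in `X`,
then `f(A, A_{v (Fin.last ℓ)}) ≥ |A_{v (Fin.last ℓ)} ∩ X| + 1`. -/
theorem seats_of_chain_above_uniquely_approved
    {P : Type*} [DecidableEq P] (n k : ℕ)
    (f : (Fin n → Finset P) → Multiset P)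
    (hrule : IsPAPPRule n k f) (hanon : Anonymous n f)
    (hsp : Strategyproof n f) (hwr : WeakRep n k f)
    (A : Fin n → Finset P) (hA : ValidProfile n A)
    (X : Finset P)
    (hXdef : ∀ x : P, x ∈ X ↔ ∃ G : Finset (Fin n), n ≤ k * G.card ∧ ∀ i ∈ G, A i = {x})
    (ℓ : ℕ) (v : Fin (ℓ + 1) → Fin n) (hv : Function.Injective v)
    (hsize : n ≤ k * (ℓ + 1))
    (hchain : ∀ a b : Fin (ℓ + 1), a ≤ b → A (v a) ⊆ A (v b))
    (hnotsub : ¬ A (v 0) ⊆ X) :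
    (A (v (Fin.last ℓ)) ∩ X).card + 1 ≤ seats (f A) (A (v (Fin.last ℓ))) := by
  obtain ⟨x, hx, hxX⟩ := Finset.not_subset.1 hnotsub
  have hvalid := fun m => validProfile_tailReplaced (v := v) (x := x) hA m
  have hcount : ∀ m, ∀ y ∈ X, 1 ≤ (f (tailReplaced A v x m)).count y := by
    intro m y hy
    obtain ⟨G, hG, hGA⟩ := (hXdef y).1 hy
    refine hwr _ (hvalid m) y G hG fun i hi => ?_
    rw [← hGA i hi]
    refine tailReplaced_of_forall_ne fun a _ hai => hnotsub ?_
    refine (hchain 0 a (Fin.zero_le a)).trans ?_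
    rw [hai, hGA i hi]
    exact Finset.singleton_subset_iff.2 hy
  have hstep : ∀ (a : Fin (ℓ + 1)) (S : Finset P), S ⊆ A (v a) →
      (S ∩ X).card + 1 ≤ seats (f (tailReplaced A v x a.val)) S →
      (A (v a) ∩ X).card + 1 ≤ seats (f (tailReplaced A v x (a.val + 1))) (A (v a)) := by
    intro a S hSa hS
    refine (seats_superset_of_forall_one_le_count (hcount a.val) hSa hS).trans ?_
    have h := hsp _ _ (hvalid (a.val + 1)) (hvalid a.val) (v a)
      fun j hj => tailReplaced_succ_of_ne hj
    rwa [tailReplaced_succ_self hv] at h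
  have hbase : 1 ≤ (f (tailReplaced A v x 0)).count x := by
    refine hwr _ (hvalid 0) x (Finset.univ.image v) ?_ fun i hi => ?_
    · simpa [Finset.card_image_of_injective _ hv] using hsize
    · obtain ⟨a, -, rfl⟩ := Finset.mem_image.1 hi
      exact tailReplaced_of_le (Nat.zero_le _)
  have hseats : ∀ a : Fin (ℓ + 1),
      (A (v a) ∩ X).card + 1 ≤ seats (f (tailReplaced A v x (a.val + 1))) (A (v a)) := by
    intro a
    induction a using Fin.induction with
    | zero =>
      refine hstep 0 {x} (Finset.singleton_subset_iff.2 hx) ?_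
      simpa [seats, Finset.singleton_inter_of_notMem hxX] using hbase
    | succ a ih => exact hstep a.succ _ (hchain _ _ (Fin.castSucc_le_succ a)) ih
  have h := hseats (Fin.last ℓ)
  rwa [Fin.val_last, tailReplaced_last] at h
end

section
/- Fix for every committee size k a linear tie-breaking order ≻_k on the committees of size k. Let w = (w_1, w_2, …) be a non-increasing sequence of nonnegative reals with w_1 = 1. The w-Thiele rule (with this tie-breaking) satisfies weak representation and strategyproofness for unrepresented voters for all committee sizes k, numbers of parties m, and numbers of voters n if and only if w = (1, 0, 0, …), i.e., the rule is CCAV. -/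
/-- The `w`-Thiele score of a committee `W` in the profile `A`:
`∑ i, (w 0 + w 1 + ⋯ + w (W(A_i) - 1))` (weights indexed from `0`, so `w 0` is the
paper's `w_1`). -/
noncomputable def thieleScore {P : Type*} [DecidableEq P] (w : ℕ → ℝ) {n : ℕ}
    (A : Fin n → Finset P) (W : Multiset P) : ℝ :=
  ∑ i : Fin n, ∑ j ∈ Finset.range (seats W (A i)), w j

/-- `f` is the `w`-Thiele rule for `n` voters and committee size `k`, with ties among
score-maximal committees broken by the (strict, linear) order `tb k`: for every valid
profile, `f A` is a committee of size `k` with maximal `w`-Thiele score that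
`tb k`-beats every other score-maximal committee of size `k`. -/
def IsThieleRule {P : Type*} [DecidableEq P] (w : ℕ → ℝ)
    (tb : ℕ → Multiset P → Multiset P → Prop) (n k : ℕ)
    (f : (Fin n → Finset P) → Multiset P) : Prop :=
  ∀ A, ValidProfile n A →
    Multiset.card (f A) = k ∧
    (∀ W : Multiset P, Multiset.card W = k → thieleScore w A W ≤ thieleScore w A (f A)) ∧
    (∀ W : Multiset P, Multiset.card W = k → W ≠ f A →
      thieleScore w A W = thieleScore w A (f A) → tb k (f A) W)

/-- Strategyproofness for unrepresented voters: a voter who approves no party of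
the elected committee cannot obtain a represented party by misreporting. -/
def SPUnrepresented {P : Type*} [DecidableEq P] (n : ℕ)
    (f : (Fin n → Finset P) → Multiset P) : Prop :=
  ∀ A A' : Fin n → Finset P, ValidProfile n A → ValidProfile n A' →
    ∀ i : Fin n, (∀ j, j ≠ i → A j = A' j) → seats (f A) (A i) = 0 →
      seats (f A') (A i) ≤ seats (f A) (A i)

theorem seats_cons {P : Type*} [DecidableEq P] (p : P) (W : Multiset P) (X : Finset P) :
    seats (p ::ₘ W) X = seats W X + if p ∈ X then 1 else 0 := by
  simp [seats, Multiset.count_cons, Finset.sum_add_distrib]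

theorem exists_isThieleRule {P : Type*} [DecidableEq P] [Fintype P] [Nonempty P]
    (w : ℕ → ℝ) (tb : ℕ → Multiset P → Multiset P → Prop) (n k : ℕ)
    (htb : IsStrictTotalOrder (Multiset P) (tb k)) :
    ∃ f : (Fin n → Finset P) → Multiset P, IsThieleRule w tb n k f := by
  classical
  have key : ∀ A : Fin n → Finset P, ∃ V : Multiset P, Multiset.card V = k ∧
      (∀ W : Multiset P, Multiset.card W = k → thieleScore w A W ≤ thieleScore w A V) ∧
      (∀ W : Multiset P, Multiset.card W = k → W ≠ V →
        thieleScore w A W = thieleScore w A V → tb k V W) := by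
    intro A
    have : Nonempty (Sym P k) := ⟨Sym.replicate k (Classical.arbitrary P)⟩
    obtain ⟨V, -, hV⟩ := Finset.exists_max_image (Finset.univ : Finset (Sym P k))
      (fun V => thieleScore w A V.1) Finset.univ_nonempty
    let ord : LinearOrder (Multiset P) := linearOrderOfSTO (tb k)
    obtain ⟨U, hU, hmin⟩ := @Finset.exists_min_image _ _ ord
      (Finset.univ.filter fun U : Sym P k => thieleScore w A U.1 = thieleScore w A V.1)
      (fun U => U.1) ⟨V, Finset.mem_filter.2 ⟨Finset.mem_univ _, rfl⟩⟩
    have hU' : thieleScore w A U.1 = thieleScore w A V.1 := (Finset.mem_filter.1 hU).2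
    refine ⟨U.1, U.2, fun W hW => ?_, fun W hW hne heq => ?_⟩
    · rw [hU']
      exact hV ⟨W, hW⟩ (Finset.mem_univ _)
    · have hle := hmin ⟨W, hW⟩ (Finset.mem_filter.2 ⟨Finset.mem_univ _, heq.trans hU'⟩)
      exact @lt_of_le_of_ne _ ord.toPartialOrder _ _ hle hne.symm
  choose f hf using key
  exact ⟨f, fun A _ => hf A⟩

theorem thieleScore_comp_equiv {P V : Type*} [DecidableEq P] [Fintype V] (w : ℕ → ℝ) {n : ℕ}
    (e : Fin n ≃ V) (B : V → Finset P) (W : Multiset P) :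
    thieleScore w (fun i => B (e i)) W = ∑ v, ∑ j ∈ Finset.range (seats W (B v)), w j :=
  e.sum_comp fun v => ∑ j ∈ Finset.range (seats W (B v)), w j

theorem sum_range_eq_ite_of_eq_zero {w : ℕ → ℝ} (hw0 : w 0 = 1) (hw : ∀ j, 1 ≤ j → w j = 0)
    (s : ℕ) : ∑ j ∈ Finset.range s, w j = if s = 0 then 0 else 1 := by
  cases s with
  | zero => simp
  | succ s =>
    rw [Finset.sum_range_succ', Finset.sum_eq_zero fun j _ => hw (j + 1) (by omega)]
    simp [hw0]

/-- Chamberlin–Courant approval voting satisfies weak representation. -/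
theorem IsThieleRule.weakRep_of_eq_zero {P : Type*} [DecidableEq P] [Fintype P] {w : ℕ → ℝ}
    (hw0 : w 0 = 1) (hw : ∀ j, 1 ≤ j → w j = 0) {tb : ℕ → Multiset P → Multiset P → Prop}
    {n k : ℕ} (hn : 1 ≤ n) {f : (Fin n → Finset P) → Multiset P}
    (hf : IsThieleRule w tb n k f) : WeakRep n k f := by
  intro A hA x G hG hx
  obtain ⟨hcard, hmax, -⟩ := hf A hA
  by_contra! hcount
  replace hcount : (f A).count x = 0 := by omega
  -- the voters who lose their only representative if a seat of `p` is removed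
  let S : P → Finset (Fin n) := fun p => Finset.univ.filter fun i =>
    seats (f A) (A i) = 1 ∧ p ∈ A i
  have hseatG : ∀ i ∈ G, seats (f A) (A i) = 0 := fun i hi => by simp [seats, hx i hi, hcount]
  have hS : ∀ p ∈ f A, G.card ≤ (S p).card := by
    intro p hp
    obtain ⟨R, hR⟩ := Multiset.exists_cons_of_mem hp
    have hle := hmax (x ::ₘ R) (by rw [← hcard, hR]; simp)
    have hvoter : ∀ i : Fin n, ((∑ j ∈ Finset.range (seats (f A) (A i)), w j) +
        if i ∈ G then 1 else 0) ≤ (∑ j ∈ Finset.range (seats (x ::ₘ R) (A i)), w j) +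
        if i ∈ S p then 1 else 0 := by
      intro i
      rw [sum_range_eq_ite_of_eq_zero hw0 hw, sum_range_eq_ite_of_eq_zero hw0 hw]
      by_cases hi : i ∈ G
      · have h0 := hseatG i hi
        have h1 : seats (x ::ₘ R) (A i) ≠ 0 := by rw [seats_cons]; simp [hx i hi]
        simp only [h0, h1, hi, if_true, if_false]
        split_ifs <;> norm_num
      · have h1 : seats (f A) (A i) = seats R (A i) + if p ∈ A i then 1 else 0 := by
          rw [hR, seats_cons]
        have h2 : seats R (A i) ≤ seats (x ::ₘ R) (A i) := by rw [seats_cons]; omega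
        have h3 : i ∈ S p ↔ seats (f A) (A i) = 1 ∧ p ∈ A i := by simp [S]
        simp only [hi, h3, if_false]
        by_cases hpi : p ∈ A i <;>
          simp only [hpi, if_true, if_false, and_true, and_false] at h1 ⊢ <;>
          split_ifs <;> first | omega | norm_num
    have hsum := Finset.sum_le_sum fun i (_ : i ∈ Finset.univ) => hvoter i
    simp only [Finset.sum_add_distrib, Finset.sum_ite_mem, Finset.univ_inter,
      Finset.sum_const, nsmul_eq_mul, mul_one] at hsum
    unfold thieleScore at hle
    have : (G.card : ℝ) ≤ (S p).card := by linarith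
    exact_mod_cast this
  have hk : ∑ p, (f A).count p = k := by
    rw [← hcard]
    exact Multiset.sum_count_eq_card fun a _ => Finset.mem_univ a
  have hlow : k * G.card ≤ ∑ p, (f A).count p * (S p).card := by
    rw [← hk, Finset.sum_mul]
    refine Finset.sum_le_sum fun p _ => ?_
    by_cases hp : p ∈ f A
    · exact Nat.mul_le_mul_left _ (hS p hp)
    · simp [Multiset.count_eq_zero_of_notMem hp]
  have hup : ∑ p, (f A).count p * (S p).card ≤ (Finset.univ \ G).card := by
    calc ∑ p, (f A).count p * (S p).card
        = ∑ p, ∑ i, (if seats (f A) (A i) = 1 ∧ p ∈ A i then (f A).count p else 0) := by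
          refine Finset.sum_congr rfl fun p _ => ?_
          rw [← Finset.sum_filter, Finset.sum_const, smul_eq_mul, mul_comm]
      _ = ∑ i, ∑ p, (if seats (f A) (A i) = 1 ∧ p ∈ A i then (f A).count p else 0) :=
          Finset.sum_comm
      _ ≤ ∑ i, (if i ∈ Finset.univ \ G then 1 else 0) := by
          refine Finset.sum_le_sum fun i _ => ?_
          by_cases h1 : seats (f A) (A i) = 1
          · have hi : i ∉ G := fun hi => by simp [hseatG i hi] at h1
            have : ∑ p, (if p ∈ A i then (f A).count p else 0) = 1 := by
              rw [← h1, seats, Finset.sum_ite_mem, Finset.univ_inter]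
            simp [h1, hi, this]
          · simp [h1]
      _ = (Finset.univ \ G).card := by
          rw [Finset.sum_ite_mem, Finset.univ_inter, Finset.sum_const, smul_eq_mul, mul_one]
  have hG0 : 0 < G.card := Nat.pos_of_ne_zero fun h => by simp [h] at hG; omega
  have hGn : (Finset.univ \ G).card + G.card = n := by
    rw [Finset.card_sdiff_add_card_eq_card (Finset.subset_univ G)]; simp
  omega

/-- Chamberlin–Courant approval voting is strategyproof for unrepresented voters. -/
theorem IsThieleRule.spUnrepresented_of_eq_zero {P : Type*} [DecidableEq P] {w : ℕ → ℝ}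
    (hw0 : w 0 = 1) (hw : ∀ j, 1 ≤ j → w j = 0) {tb : ℕ → Multiset P → Multiset P → Prop}
    {n k : ℕ} (htb : IsStrictTotalOrder (Multiset P) (tb k))
    {f : (Fin n → Finset P) → Multiset P} (hf : IsThieleRule w tb n k f) :
    SPUnrepresented n f := by
  intro A A' hA hA' i hne h0
  obtain ⟨hc, hmax, htie⟩ := hf A hA
  obtain ⟨hc', hmax', htie'⟩ := hf A' hA'
  by_contra! hlt
  have hWW : f A ≠ f A' := fun h => by rw [h] at hlt; omega
  have hsplit : ∀ (B : Fin n → Finset P) (W : Multiset P), thieleScore w B W =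
      (if seats W (B i) = 0 then 0 else 1) +
        ∑ j ∈ Finset.univ.erase i, ∑ l ∈ Finset.range (seats W (B j)), w l := by
    intro B W
    rw [thieleScore, ← Finset.add_sum_erase _ _ (Finset.mem_univ i),
      sum_range_eq_ite_of_eq_zero hw0 hw]
  have hrest : ∀ W : Multiset P,
      ∑ j ∈ Finset.univ.erase i, ∑ l ∈ Finset.range (seats W (A' j)), w l =
      ∑ j ∈ Finset.univ.erase i, ∑ l ∈ Finset.range (seats W (A j)), w l := fun W =>
    Finset.sum_congr rfl fun j hj => by rw [hne j (Finset.ne_of_mem_erase hj)]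
  have e1 := hmax _ hc'
  have e2 := hmax' _ hc
  have e3 : thieleScore w A (f A') = thieleScore w A (f A) ∧
      thieleScore w A' (f A) = thieleScore w A' (f A') := by
    have h1 : seats (f A') (A i) ≠ 0 := by omega
    rw [hsplit, hsplit] at e1 e2
    rw [hrest, hrest] at e2
    rw [hsplit, hsplit, hsplit, hsplit, hrest, hrest]
    simp only [h0, h1, if_true, if_false] at e1 ⊢
    constructor <;> split_ifs at e2 ⊢ <;> linarith
  exact asymm_of (tb k) (htie _ hc' hWW.symm e3.1) (htie' _ hc hWW e3.2)

/-- Weak representation forces the second weight to be smaller than the first one. -/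
theorem weight_one_lt_one_of_weakRep {w : ℕ → ℝ} (hw0 : w 0 = 1)
    (hmono : ∀ i j : ℕ, i ≤ j → w j ≤ w i) {tb : ℕ → Multiset (Fin 3) → Multiset (Fin 3) → Prop}
    {f : (Fin 8 → Finset (Fin 3)) → Multiset (Fin 3)}
    (hf : IsThieleRule w tb 8 4 f) (hrep : WeakRep 8 4 f) : w 1 < 1 := by
  by_contra! hge
  have hw1 : w 1 = 1 := le_antisymm (hw0 ▸ hmono 0 1 (by omega)) hge
  have hsum : ∀ s, ∑ j ∈ Finset.range s, w j ≤ s := fun s => by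
    have hle : ∀ j ∈ Finset.range s, w j ≤ 1 := fun j _ => hw0 ▸ hmono 0 j j.zero_le
    simpa using Finset.sum_le_sum hle
  let A : Fin 8 → Finset (Fin 3) := ![{0}, {0}, {0}, {1}, {1}, {1}, {2}, {2}]
  have hA : ValidProfile 8 A := by intro i; fin_cases i <;> simp [A]
  obtain ⟨hc, hmax, -⟩ := hf A hA
  have hx := hrep A hA 2 {6, 7} (by decide) (by intro i hi; fin_cases hi <;> simp [A])
  have hle := hmax {0, 0, 1, 1} (by simp)
  have hcard : (f A).count 0 + (f A).count 1 + (f A).count 2 = 4 := by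
    rw [← hc, ← Multiset.sum_count_eq_card (s := Finset.univ) fun a _ => Finset.mem_univ a,
      Fin.sum_univ_three]
  have s0 := hsum ((f A).count 0)
  have s1 := hsum ((f A).count 1)
  have s2 := hsum ((f A).count 2)
  have hcard' : ((f A).count 0 : ℝ) + (f A).count 1 + (f A).count 2 = 4 := by
    exact_mod_cast hcard
  have hx' : (1 : ℝ) ≤ (f A).count 2 := by exact_mod_cast hx
  simp [thieleScore, Fin.sum_univ_eight, A, seats, Finset.sum_range_succ, hw0, hw1,
    Multiset.count_cons] at hle
  linarith

/-- The voters of the profiles `manipulationProfile N D T t`. -/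
abbrev ManipulationVoter (N D T : ℕ) : Type := (Fin N × Fin 4) ⊕ (Fin D ⊕ Fin T)

/-- Both `{0, 1}` and `{2, 3}` represent all voters of the first block, `D` voters support
party `0`, and among the last `T` voters the first `t` ones approve `{2, 3}` while the other
ones approve only party `2`. -/
def manipulationProfile (N D T t : ℕ) : ManipulationVoter N D T → Finset (Fin 4)
  | .inl (_, r) => ![{0, 2}, {0, 3}, {1, 2}, {1, 3}] r
  | .inr (.inl _) => {0}
  | .inr (.inr j) => if j.1 < t then {2, 3} else {2}

theorem manipulationProfile_nonempty (N D T t : ℕ) (v : ManipulationVoter N D T) :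
    (manipulationProfile N D T t v).Nonempty := by
  rcases v with ⟨_, r⟩ | _ | j
  · fin_cases r <;> simp [manipulationProfile]
  · simp [manipulationProfile]
  · simp only [manipulationProfile]
    split_ifs <;> simp

theorem sum_manipulationProfile (N D T t : ℕ) (g : Finset (Fin 4) → ℝ) :
    ∑ v, g (manipulationProfile N D T t v) =
      N * (g {0, 2} + g {0, 3} + g {1, 2} + g {1, 3}) + D * g {0} +
        ∑ j : Fin T, g (if j.1 < t then {2, 3} else {2}) := by
  simp [Fintype.sum_sum_type, Fintype.sum_prod_type, Fin.sum_univ_four, manipulationProfile,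
    mul_add, add_assoc]

/-- If the second weight lies strictly between `0` and `1`, then the Thiele rule is not
strategyproof for unrepresented voters. -/
theorem not_forall_spUnrepresented {w : ℕ → ℝ} (hw0 : w 0 = 1) (hpos : 0 < w 1) (hlt : w 1 < 1)
    {tb : ℕ → Multiset (Fin 4) → Multiset (Fin 4) → Prop}
    (htb : IsStrictTotalOrder (Multiset (Fin 4)) (tb 2)) :
    ∃ n, 1 ≤ n ∧ ∃ f : (Fin n → Finset (Fin 4)) → Multiset (Fin 4),
      IsThieleRule w tb n 2 f ∧ ¬ SPUnrepresented n f := by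
  obtain ⟨T, hT⟩ := exists_nat_gt (1 / w 1)
  rw [div_lt_iff₀ hpos] at hT
  obtain ⟨N, hN⟩ := exists_nat_gt (2 * (T + 1) / (1 - w 1))
  rw [div_lt_iff₀ (by linarith)] at hN
  let e := (Fintype.equivFin (ManipulationVoter N (T + 1) T)).symm
  obtain ⟨f, hf⟩ := exists_isThieleRule w tb
    (Fintype.card (ManipulationVoter N (T + 1) T)) 2 htb
  refine ⟨_, Fintype.card_pos, f, hf, fun hsp => ?_⟩
  let A : ℕ → Fin _ → Finset (Fin 4) := fun t i => manipulationProfile N (T + 1) T t (e i)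
  have hA : ∀ t, ValidProfile _ (A t) := fun t i => manipulationProfile_nonempty ..
  have hscore : ∀ t W, thieleScore w (A t) W = _ := fun t W =>
    (thieleScore_comp_equiv w e (manipulationProfile N (T + 1) T t) W).trans
      (sum_manipulationProfile N (T + 1) T t fun X => ∑ j ∈ Finset.range (seats W X), w j)
  have hcount : ∀ t, (f (A t)).count 0 + (f (A t)).count 1 + (f (A t)).count 2 +
      (f (A t)).count 3 = 2 := fun t => by
    rw [← (hf (A t) (hA t)).1,
      ← Multiset.sum_count_eq_card (s := Finset.univ) fun a _ => Finset.mem_univ a,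
      Fin.sum_univ_four]
  have hTnonneg : (0 : ℝ) ≤ T := T.cast_nonneg
  have hT1 : (T : ℝ) * w 1 < T + 1 := by nlinarith
  have hstart : (f (A 0)).count 2 = 0 := by
    by_contra hne
    have hle := (hf (A 0) (hA 0)).2.1 {0, 1} (by simp)
    have hc := hcount 0
    rw [hscore, hscore] at hle
    generalize f (A 0) = W at *
    simp [seats, Multiset.count_cons, hw0] at hle
    obtain ⟨c0, h0⟩ : ∃ c, W.count 0 = c := ⟨_, rfl⟩
    obtain ⟨c1, h1⟩ : ∃ c, W.count 1 = c := ⟨_, rfl⟩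
    obtain ⟨c2, h2⟩ : ∃ c, W.count 2 = c := ⟨_, rfl⟩
    obtain ⟨c3, h3⟩ : ∃ c, W.count 3 = c := ⟨_, rfl⟩
    rw [h0, h1, h2, h3] at hc
    rw [h0, h1, h2, h3] at hle
    rw [h2] at hne
    have : c0 ≤ 2 := by omega
    have : c1 ≤ 2 := by omega
    have : c2 ≤ 2 := by omega
    obtain rfl : c3 = 2 - c0 - c1 - c2 := by omega
    interval_cases c0 <;> interval_cases c1 <;> interval_cases c2 <;> try omega
    all_goals
      simp [Finset.sum_range_succ, hw0] at hle
      nlinarith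
  have hend : (f (A T)).count 2 ≠ 0 := by
    intro hz
    have hle := (hf (A T) (hA T)).2.1 {2, 3} (by simp)
    have hc := hcount T
    rw [hscore, hscore] at hle
    generalize f (A T) = W at *
    simp [seats, Multiset.count_cons, hw0, Finset.sum_range_succ] at hle
    obtain ⟨c0, h0⟩ : ∃ c, W.count 0 = c := ⟨_, rfl⟩
    obtain ⟨c1, h1⟩ : ∃ c, W.count 1 = c := ⟨_, rfl⟩
    obtain ⟨c3, h3⟩ : ∃ c, W.count 3 = c := ⟨_, rfl⟩
    rw [h0, h1, hz, h3] at hc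
    rw [h0, h1, hz, h3] at hle
    have : c0 ≤ 2 := by omega
    have : c1 ≤ 2 := by omega
    obtain rfl : c3 = 2 - c0 - c1 := by omega
    interval_cases c0 <;> interval_cases c1 <;> try omega
    all_goals
      simp [Finset.sum_range_succ, hw0] at hle
      nlinarith
  -- the first deviation after which party `2` is elected
  have hex : ∃ t, (f (A t)).count 2 ≠ 0 := ⟨T, hend⟩
  obtain ⟨t, ht⟩ : ∃ t, Nat.find hex = t + 1 :=
    Nat.exists_eq_succ_of_ne_zero fun h => (h ▸ Nat.find_spec hex :) hstart
  have htT : t < T := by have := Nat.find_min' hex hend; omega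
  have hbefore : (f (A t)).count 2 = 0 := not_not.1 (Nat.find_min hex (by omega))
  have hafter : (f (A (t + 1))).count 2 ≠ 0 := ht ▸ Nat.find_spec hex
  have hAi : A t (e.symm (.inr (.inr ⟨t, htT⟩))) = {2} := by simp [A, manipulationProfile]
  have hdev := hsp (A t) (A (t + 1)) (hA _) (hA _) (e.symm (.inr (.inr ⟨t, htT⟩)))
    (fun j hj => by
      have hj' : e j ≠ .inr (.inr ⟨t, htT⟩) := fun h => hj (by rw [← h]; simp)
      simp only [A]
      generalize e j = v at hj' ⊢
      rcases v with _ | _ | l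
      · rfl
      · rfl
      · have hl : l.1 ≠ t := fun h => hj' (by simp [Fin.ext_iff, h])
        have hiff : l.1 < t ↔ l.1 < t + 1 := by omega
        simp only [manipulationProfile, hiff])
    (by rw [hAi]; simp only [seats, Finset.sum_singleton, hbefore])
  rw [hAi] at hdev
  simp only [seats, Finset.sum_singleton] at hdev
  omega

/-- Let `w` be a non-increasing sequence of nonnegative reals with
`w 0 = 1` and fix, for every number of parties `m` and committee size `k`, a linear
(strict total) tie-breaking order `tb m k` on committees. The `w`-Thiele rule satisfies
weak representation and strategyproofness for unrepresented voters for all committee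
sizes `k`, numbers of parties `m`, and numbers of voters `n ≥ 1` if and only if
`w = (1, 0, 0, …)`, i.e. the rule is CCAV. -/
theorem thiele_weakRep_SPUnrep_iff_CCAV
    (w : ℕ → ℝ) (hw0 : w 0 = 1)
    (hmono : ∀ i j : ℕ, i ≤ j → w j ≤ w i) (hnonneg : ∀ j : ℕ, 0 ≤ w j)
    (tb : ∀ m : ℕ, ℕ → Multiset (Fin m) → Multiset (Fin m) → Prop)
    (htb : ∀ m k : ℕ, IsStrictTotalOrder (Multiset (Fin m)) (tb m k)) :
    (∀ (n m k : ℕ), 1 ≤ n →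
        ∀ f : (Fin n → Finset (Fin m)) → Multiset (Fin m),
          IsThieleRule w (tb m) n k f → WeakRep n k f ∧ SPUnrepresented n f)
      ↔ (∀ j : ℕ, 1 ≤ j → w j = 0) := by
  constructor
  · intro h j hj
    obtain ⟨f, hf⟩ := exists_isThieleRule w (tb 3) 8 4 (htb 3 4)
    have hlt := weight_one_lt_one_of_weakRep hw0 hmono hf (h 8 3 4 (by omega) f hf).1
    have hle : w 1 ≤ 0 := by
      by_contra! hpos
      obtain ⟨n, hn, g, hg, hnot⟩ := not_forall_spUnrepresented hw0 hpos hlt (htb 4 2)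
      exact hnot (h n 4 2 hn g hg).2
    exact le_antisymm ((hmono 1 j hj).trans hle) (hnonneg j)
  · intro hw n m k hn f hf
    exact ⟨hf.weakRep_of_eq_zero hw0 hw hn, hf.spUnrepresented_of_eq_zero hw0 hw (htb m k)⟩
end

section
/- For every number of voters n, every finite set of parties 𝒫, every committee size k, and every family of linear tie-breaking orders ≻_k on committees, the rule CCAV (the w-Thiele rule with w = (1,0,0,…), breaking ties by ≻_k) satisfies weak representation. -/
/-- The CCAV weight vector `(1, 0, 0, …)` (indexed from `0`). -/
noncomputable def ccavWeights : ℕ → ℝ := fun j => if j = 0 then 1 else 0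

theorem thieleScore_ccavWeights {P : Type*} [DecidableEq P] {n : ℕ}
    (A : Fin n → Finset P) (W : Multiset P) :
    thieleScore ccavWeights A W =
      ((Finset.univ.filter fun i => 0 < seats W (A i)).card : ℝ) := by
  simp [thieleScore, ccavWeights]

/-- The voters represented by exactly one seat of `W`, that seat being held by `y`. -/
def criticalVoters {P : Type*} [DecidableEq P] {n : ℕ} (A : Fin n → Finset P)
    (W : Multiset P) (y : P) : Finset (Fin n) :=
  Finset.univ.filter fun i => seats W (A i) = 1 ∧ y ∈ A i

theorem sum_card_criticalVoters {P : Type*} [DecidableEq P] {n : ℕ}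
    (A : Fin n → Finset P) (W : Multiset P) :
    (W.map fun y => (criticalVoters A W y).card).sum =
      (Finset.univ.filter fun i => seats W (A i) = 1).card := by
  have h : ∀ V : Multiset P, (V.map fun y => (criticalVoters A W y).card).sum =
      ∑ i, if seats W (A i) = 1 then seats V (A i) else 0 := by
    intro V
    induction V using Multiset.induction_on with
    | empty => simp [seats]
    | cons a V ih =>
      rw [Multiset.map_cons, Multiset.sum_cons, ih, criticalVoters, Finset.card_filter,
        ← Finset.sum_add_distrib]
      refine Finset.sum_congr rfl fun i _ => ?_
      rw [seats_eq_countP (a ::ₘ V), seats_eq_countP V, Multiset.countP_cons]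
      split_ifs <;> simp_all [add_comm]
  rw [h, Finset.card_filter]
  refine Finset.sum_congr rfl fun i _ => ?_
  split_ifs with h1
  · exact h1
  · rfl

/-- For every number of voters `n ≥ 1`, finite set of parties `P`,
committee size `k`, and family of linear tie-breaking orders on committees, CCAV
(the `w`-Thiele rule with `w = (1,0,0,…)`) satisfies weak representation. -/
theorem ccav_satisfies_weakRep
    {P : Type*} [DecidableEq P] [Fintype P]
    (tb : ℕ → Multiset P → Multiset P → Prop)
    (htb : ∀ k : ℕ, IsStrictTotalOrder (Multiset P) (tb k))
    (n k : ℕ) (hn : 1 ≤ n)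
    (f : (Fin n → Finset P) → Multiset P)
    (hf : IsThieleRule ccavWeights tb n k f) :
    WeakRep n k f := by
  intro A hA x G hG hx
  obtain ⟨hcard, hmax, -⟩ := hf A hA
  generalize f A = W at *
  by_contra hcount
  have hGW : ∀ i ∈ G, seats W (A i) = 0 := by
    intro i hi
    simp only [seats, hx i hi, Finset.sum_singleton]
    omega
  have hGpos : 0 < G.card := by
    rcases Nat.eq_zero_or_pos G.card with h | h
    · simp [h] at hG; omega
    · exact h
  obtain ⟨y, hyW, hy⟩ : ∃ y ∈ W, (criticalVoters A W y).card < G.card := by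
    by_contra! hall
    have hlow : W.card • G.card ≤ (W.map fun y => (criticalVoters A W y).card).sum := by
      have := Multiset.card_nsmul_le_sum
        (s := W.map fun y => (criticalVoters A W y).card) (a := G.card)
        (by simpa using hall)
      simpa using this
    rw [sum_card_criticalVoters, hcard, smul_eq_mul] at hlow
    have hdisj : Disjoint (Finset.univ.filter fun i => seats W (A i) = 1) G := by
      rw [Finset.disjoint_left]
      intro i hi hiG
      simp [hGW i hiG] at hi
    have hle := Finset.card_le_univ
      ((Finset.univ.filter fun i => seats W (A i) = 1) ∪ G)
    rw [Finset.card_union_of_disjoint hdisj, Fintype.card_fin] at hle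
    omega
  have hW' := hmax (x ::ₘ W.erase y) (by
    rw [Multiset.card_cons, Multiset.card_erase_add_one hyW, hcard])
  rw [thieleScore_ccavWeights, thieleScore_ccavWeights, Nat.cast_le] at hW'
  have hsub : (Finset.univ.filter fun i => 0 < seats W (A i)) ∪ G ⊆
      (Finset.univ.filter fun i => 0 < seats (x ::ₘ W.erase y) (A i)) ∪
        criticalVoters A W y := by
    intro i hi
    have hW : seats W (A i) =
        seats (W.erase y) (A i) + if y ∈ A i then 1 else 0 := by
      conv_lhs => rw [← Multiset.cons_erase hyW]
      rw [seats_eq_countP, seats_eq_countP, Multiset.countP_cons]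
    have hnew : seats (x ::ₘ W.erase y) (A i) =
        seats (W.erase y) (A i) + if x ∈ A i then 1 else 0 := by
      rw [seats_eq_countP, seats_eq_countP, Multiset.countP_cons]
    simp only [criticalVoters, Finset.mem_union, Finset.mem_filter, Finset.mem_univ,
      true_and] at hi ⊢
    rcases hi with hi | hi
    · by_cases hyi : y ∈ A i
      · simp only [hyi, if_true, and_true] at hW ⊢
        omega
      · simp only [hyi, if_false] at hW
        omega
    · left
      rw [hnew]
      simp [hx i hi]
  have hdisj : Disjoint (Finset.univ.filter fun i => 0 < seats W (A i)) G := by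
    rw [Finset.disjoint_left]
    intro i hi hiG
    simp [hGW i hiG] at hi
  have h1 := Finset.card_le_card hsub
  rw [Finset.card_union_of_disjoint hdisj] at h1
  have h2 := h1.trans (Finset.card_union_le _ _)
  omega
end

section
/- For every number of voters n, every finite set of parties 𝒫, every committee size k, and every family of linear tie-breaking orders ≻_k on committees, the rule CCAV (the w-Thiele rule with w = (1,0,0,…), breaking ties by ≻_k) satisfies strategyproofness for unrepresented voters. -/
/-- Under the CCAV weights, `m` approved seats contribute `1` if `m ≠ 0` and `0` otherwise. -/
theorem sum_range_ccavWeights (m : ℕ) :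
    ∑ j ∈ Finset.range m, ccavWeights j = if m = 0 then 0 else 1 := by
  cases m <;> simp [ccavWeights]

/-- The Thiele score splits into the contribution of voter `i` and that of the other voters. -/
theorem thieleScore_eq_add_sum_erase {P : Type*} [DecidableEq P] (w : ℕ → ℝ) {n : ℕ}
    (A : Fin n → Finset P) (W : Multiset P) (i : Fin n) :
    thieleScore w A W = ∑ j ∈ Finset.range (seats W (A i)), w j +
      ∑ v ∈ Finset.univ.erase i, ∑ j ∈ Finset.range (seats W (A v)), w j :=
  (Finset.add_sum_erase _ _ (Finset.mem_univ i)).symm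

/-- For every number of voters `n`, finite set of parties `P`,
committee size `k`, and family of linear tie-breaking orders on committees, CCAV
(the `w`-Thiele rule with `w = (1,0,0,…)`) satisfies strategyproofness for
unrepresented voters. -/
theorem ccav_satisfies_SPUnrepresented
    {P : Type*} [DecidableEq P] [Fintype P]
    (tb : ℕ → Multiset P → Multiset P → Prop)
    (htb : ∀ k : ℕ, IsStrictTotalOrder (Multiset P) (tb k))
    (n k : ℕ)
    (f : (Fin n → Finset P) → Multiset P)
    (hf : IsThieleRule ccavWeights tb n k f) :
    SPUnrepresented n f := by
  intro A A' hA hA' i hAA' h0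
  obtain ⟨hcard, hmax, htie⟩ := hf A hA
  obtain ⟨hcard', hmax', htie'⟩ := hf A' hA'
  rw [h0, Nat.le_zero]
  by_contra hrep
  have hne : f A' ≠ f A := fun h => hrep (h ▸ h0)
  have hothers (W : Multiset P) :
      ∑ v ∈ Finset.univ.erase i, ∑ j ∈ Finset.range (seats W (A' v)), ccavWeights j =
        ∑ v ∈ Finset.univ.erase i, ∑ j ∈ Finset.range (seats W (A v)), ccavWeights j :=
    Finset.sum_congr rfl fun v hv => by rw [hAA' v (Finset.ne_of_mem_erase hv)]
  have hle := hmax _ hcard'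
  have hle' := hmax' _ hcard
  have htie := htie _ hcard' hne
  have htie' := htie' _ hcard hne.symm
  simp only [thieleScore_eq_add_sum_erase _ _ _ i, hothers] at hle hle' htie htie'
  simp only [sum_range_ccavWeights, h0, if_neg hrep, if_true] at hle hle' htie htie'
  have := htb k
  refine asymm_of (tb k) (htie ?_) (htie' ?_) <;> split_ifs at hle' ⊢ <;> linarith
end

section
/- Let g : ℕ → ℝ_{>0} be a monotone function such that there exist ℓ, j ∈ ℕ with (ℓ+1)/g(j) ≤ ℓ/g(0) (i.e., the divisor method based on majoritarian portioning defined by g is not approval voting), and fix a linear tie-breaking order on parties. Then there exist a committee size k, a number of parties m, and a number of voters n such that the divisor method based on majoritarian portioning defined by g fails strategyproofness for unrepresented voters, i.e., there exist profiles A, A' and a voter i with A_j = A'_j for all j ≠ i, f(A, A_i) = 0, and f(A', A_i) > 0, where f denotes this rule. -/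
/-- The voters in `R` that approve party `x`. -/
def approvers {P : Type*} [DecidableEq P] {n : ℕ} (A : Fin n → Finset P)
    (R : Finset (Fin n)) (x : P) : Finset (Fin n) :=
  R.filter fun i => x ∈ A i

/-- `wt` is the weight function computed by majoritarian portioning on the profile `A`
(ties broken by the strict linear order `tbp` on parties): it proceeds in rounds; in
each round the party `x r` approved by the most remaining voters is selected, its
weight is set to that number of voters, and those voters are removed; parties never
selected get weight `0`. -/
def IsMajPortioning {P : Type*} [DecidableEq P] (tbp : P → P → Prop) {n : ℕ}
    (A : Fin n → Finset P) (wt : P → ℕ) : Prop :=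
  ∃ (s : ℕ) (R : ℕ → Finset (Fin n)) (x : ℕ → P),
    R 0 = Finset.univ ∧ R s = ∅ ∧
    (∀ r < s,
      (R r).Nonempty ∧
      (∀ y : P, (approvers A (R r) y).card ≤ (approvers A (R r) (x r)).card) ∧
      (∀ y : P, y ≠ x r →
        (approvers A (R r) y).card = (approvers A (R r) (x r)).card → tbp (x r) y) ∧
      wt (x r) = (approvers A (R r) (x r)).card ∧
      R (r + 1) = R r \ approvers A (R r) (x r)) ∧
    (∀ y : P, (∀ r < s, y ≠ x r) → wt y = 0)

/-- `f` is the divisor method based on majoritarian portioning defined by the divisor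
function `g`, for `n` voters and committee size `k`, with ties broken by the strict
linear order `tbp` on parties: weights are computed by majoritarian portioning, and
the `k` seats are assigned in rounds, each round giving a seat to a party `x`
maximizing `wt x / g(t_x)`, where `t_x` is the number of seats `x` has so far. -/
def IsDivisorMajPortRule {P : Type*} [DecidableEq P] (g : ℕ → ℝ) (tbp : P → P → Prop)
    (n k : ℕ) (f : (Fin n → Finset P) → Multiset P) : Prop :=
  ∀ A, ValidProfile n A →
    ∃ wt : P → ℕ, IsMajPortioning tbp A wt ∧
      ∃ c : ℕ → Multiset P, c 0 = 0 ∧ f A = c k ∧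
        ∀ t < k, ∃ x : P,
          c (t + 1) = x ::ₘ c t ∧
          (∀ y : P, (wt y : ℝ) / g ((c t).count y) ≤ (wt x : ℝ) / g ((c t).count x)) ∧
          (∀ y : P, y ≠ x →
            (wt y : ℝ) / g ((c t).count y) = (wt x : ℝ) / g ((c t).count x) → tbp x y)

/-- A finite, nonempty family of scores has a maximizer that wins the tie-breaking
against every other maximizer. -/
lemma exists_argmax_tieBreak {P α : Type*} [Finite P] [Nonempty P] [LinearOrder α]
    (tb : P → P → Prop) [IsStrictTotalOrder P tb] (score : P → α) :
    ∃ x : P, (∀ y, score y ≤ score x) ∧ ∀ y, y ≠ x → score y = score x → tb x y := by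
  obtain ⟨x₀, hx₀⟩ := Finite.exists_max score
  have hwf : WellFounded tb := Finite.wellFounded_of_trans_of_irrefl tb
  obtain ⟨x, hx, hmin⟩ := hwf.has_min {x | ∀ y, score y ≤ score x} ⟨x₀, hx₀⟩
  refine ⟨x, hx, fun y hyx hy => ?_⟩
  rcases trichotomous_of tb x y with h | h | h
  · exact h
  · exact absurd h.symm hyx
  · exact absurd h (hmin y fun u => hy ▸ hx u)

lemma exists_isMajPortioning {P : Type*} [DecidableEq P] [Finite P] [Nonempty P]
    (tb : P → P → Prop) [IsStrictTotalOrder P tb] {n : ℕ} (A : Fin n → Finset P)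
    (hA : ValidProfile n A) : ∃ wt : P → ℕ, IsMajPortioning tb A wt := by
  choose pick hmax htie using fun R : Finset (Fin n) =>
    exists_argmax_tieBreak tb fun y => (approvers A R y).card
  let R : ℕ → Finset (Fin n) := fun r =>
    Nat.rec Finset.univ (fun _ S => S \ approvers A S (pick S)) r
  have hsucc : ∀ r, R (r + 1) = R r \ approvers A (R r) (pick (R r)) := fun _ => rfl
  have hanti : Antitone R := antitone_nat_of_succ_le fun r => by
    rw [hsucc]; exact Finset.sdiff_subset
  have hex : ∃ s, R s = ∅ := by
    by_contra! hne
    have hlt : ∀ r, (R (r + 1)).card < (R r).card := fun r => by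
      obtain ⟨i, hi⟩ := hne r
      obtain ⟨p, hp⟩ := hA i
      have hpos : 0 < (approvers A (R r) p).card :=
        Finset.card_pos.2 ⟨i, Finset.mem_filter.2 ⟨hi, hp⟩⟩
      obtain ⟨u, hu⟩ := Finset.card_pos.1 (hpos.trans_le (hmax (R r) p))
      refine Finset.card_lt_card ((Finset.ssubset_iff_of_subset (hanti r.le_succ)).2
        ⟨u, (Finset.mem_filter.1 hu).1, ?_⟩)
      rw [hsucc]
      simp [hu]
    have hle : ∀ r, (R r).card + r ≤ (R 0).card := fun r => by
      induction r with
      | zero => simp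
      | succ r ih => have := hlt r; omega
    have := hle ((R 0).card + 1)
    omega
  obtain ⟨s, hs, hne⟩ : ∃ s, R s = ∅ ∧ ∀ r < s, (R r).Nonempty := by
    classical
    exact ⟨Nat.find hex, Nat.find_spec hex, fun r hr =>
      Finset.nonempty_iff_ne_empty.2 (Nat.find_min hex hr)⟩
  refine ⟨fun y => ∑ r ∈ Finset.range s,
      if pick (R r) = y then (approvers A (R r) (pick (R r))).card else 0,
    s, R, fun r => pick (R r), rfl, hs, fun r hr =>
      ⟨hne r hr, hmax _, htie _, ?_, rfl⟩, ?_⟩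
  · have hdisj : ∀ a b, a < b → approvers A (R b) (pick (R a)) = ∅ := fun a b hab => by
      refine Finset.eq_empty_of_forall_notMem fun i hi => ?_
      obtain ⟨hib, hia⟩ := Finset.mem_filter.1 hi
      have hi' := hanti hab hib
      rw [hsucc, Finset.mem_sdiff] at hi'
      exact hi'.2 (Finset.mem_filter.2 ⟨hi'.1, hia⟩)
    dsimp only
    rw [Finset.sum_eq_single r, if_pos rfl]
    · intro b _ hbr
      split_ifs with hpick
      · rcases lt_or_gt_of_ne hbr with hlt | hlt
        · have h := hdisj b r hlt
          have hpos : approvers A (R r) (pick (R r)) = ∅ := hpick ▸ h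
          obtain ⟨i, hi⟩ := hne r hr
          obtain ⟨p, hp⟩ := hA i
          have := hmax (R r) p
          rw [hpos, Finset.card_empty, Nat.le_zero, Finset.card_eq_zero] at this
          have hip : i ∈ approvers A (R r) p := Finset.mem_filter.2 ⟨hi, hp⟩
          rw [this] at hip
          exact absurd hip (Finset.notMem_empty i)
        · rw [hpick, hdisj r b hlt, Finset.card_empty]
      · rfl
    · intro h
      exact absurd (Finset.mem_range.2 hr) h
  · intro y hy
    refine Finset.sum_eq_zero fun r hr => if_neg fun h => hy r (Finset.mem_range.1 hr) h.symm

lemma exists_isDivisorMajPortRule {P : Type*} [DecidableEq P] [Finite P] [Nonempty P]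
    (g : ℕ → ℝ) (tb : P → P → Prop) [IsStrictTotalOrder P tb] (n k : ℕ) :
    ∃ f : (Fin n → Finset P) → Multiset P, IsDivisorMajPortRule g tb n k f := by
  have key : ∀ A : Fin n → Finset P, ∃ W : Multiset P, ValidProfile n A →
      ∃ wt : P → ℕ, IsMajPortioning tb A wt ∧
      ∃ c : ℕ → Multiset P, c 0 = 0 ∧ W = c k ∧
        ∀ t < k, ∃ x : P, c (t + 1) = x ::ₘ c t ∧
          (∀ y : P, (wt y : ℝ) / g ((c t).count y) ≤ (wt x : ℝ) / g ((c t).count x)) ∧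
          (∀ y : P, y ≠ x →
            (wt y : ℝ) / g ((c t).count y) = (wt x : ℝ) / g ((c t).count x) → tb x y) := by
    intro A
    by_cases hA : ValidProfile n A
    · obtain ⟨wt, hwt⟩ := exists_isMajPortioning tb A hA
      choose pick hmax htie using fun W : Multiset P =>
        exists_argmax_tieBreak tb fun y => (wt y : ℝ) / g (W.count y)
      let c : ℕ → Multiset P := fun t => Nat.rec 0 (fun _ W => pick W ::ₘ W) t
      exact ⟨c k, fun _ => ⟨wt, hwt, c, rfl, rfl, fun t _ =>
        ⟨pick (c t), rfl, hmax (c t), htie (c t)⟩⟩⟩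
    · exact ⟨0, fun h => absurd h hA⟩
  choose f hf using key
  exact ⟨f, hf⟩

/-- The number of voters approving `q` but no party of `S`. -/
def approvalsAvoiding {P : Type*} [DecidableEq P] {n : ℕ} (A : Fin n → Finset P)
    (S : Finset P) (q : P) : ℕ :=
  (Finset.univ.filter fun i => q ∈ A i ∧ Disjoint S (A i)).card

/-- If `p₀` and then `p₁` are forced winners of the first two rounds of majoritarian
portioning, their weights are determined and every other weight is bounded. -/
lemma IsMajPortioning.weights_of_first_two {P : Type*} [DecidableEq P] {tb : P → P → Prop}
    {n : ℕ} {A : Fin n → Finset P} {wt : P → ℕ} (H : IsMajPortioning tb A wt) {p₀ p₁ : P}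
    (pos₀ : 0 < approvalsAvoiding A ∅ p₀) (pos₁ : 0 < approvalsAvoiding A {p₀} p₁)
    (win₀ : ∀ q, q ≠ p₀ → approvalsAvoiding A ∅ q < approvalsAvoiding A ∅ p₀ ∨
      approvalsAvoiding A ∅ q ≤ approvalsAvoiding A ∅ p₀ ∧ ¬ tb q p₀)
    (win₁ : ∀ q, q ≠ p₁ → approvalsAvoiding A {p₀} q < approvalsAvoiding A {p₀} p₁) :
    wt p₀ = approvalsAvoiding A ∅ p₀ ∧ wt p₁ = approvalsAvoiding A {p₀} p₁ ∧
      ∀ q, q ≠ p₀ → q ≠ p₁ → wt q ≤ approvalsAvoiding A {p₀, p₁} q := by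
  obtain ⟨s, R, x, hR0, hRs, hstep, hzero⟩ := H
  have card₀ : ∀ q, (approvers A (R 0) q).card = approvalsAvoiding A ∅ q := fun q => by
    rw [hR0]; simp [approvers, approvalsAvoiding]
  have hs0 : 0 < s := by
    rcases Nat.eq_zero_or_pos s with rfl | h
    · have := card₀ p₀
      rw [hRs] at this
      simp only [approvers, Finset.filter_empty, Finset.card_empty] at this
      omega
    · exact h
  obtain ⟨-, hmax0, htie0, hwt0, hR1⟩ := hstep 0 hs0
  have hx0 : x 0 = p₀ := by
    by_contra hne
    have h := hmax0 p₀
    have ht := htie0 p₀ (Ne.symm hne)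
    rw [card₀, card₀] at h ht
    rcases win₀ _ hne with h' | ⟨h', htb⟩
    · omega
    · exact htb (ht (le_antisymm h h'))
  rw [hx0] at hwt0 hR1
  have card₁ : ∀ q, (approvers A (R 1) q).card = approvalsAvoiding A {p₀} q := fun q => by
    rw [hR1, hR0]
    unfold approvers approvalsAvoiding
    congr 1
    ext i
    simp [and_comm]
  have hs1 : 1 < s := by
    rcases (Nat.succ_le_of_lt hs0).eq_or_lt with h | h
    · have := card₁ p₁
      rw [show (1 : ℕ) = s from h, hRs] at this
      simp only [approvers, Finset.filter_empty, Finset.card_empty] at this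
      omega
    · exact h
  obtain ⟨-, hmax1, -, hwt1, hR2⟩ := hstep 1 hs1
  have hx1 : x 1 = p₁ := by
    by_contra hne
    have h := hmax1 p₁
    rw [card₁, card₁] at h
    have := win₁ _ hne
    omega
  rw [hx1] at hwt1 hR2
  refine ⟨by rw [hwt0, card₀], by rw [hwt1, card₁], fun q hq0 hq1 => ?_⟩
  by_cases hq : ∀ r < s, q ≠ x r
  · simp [hzero q hq]
  push Not at hq
  obtain ⟨r, hr, rfl⟩ := hq
  have hr2 : 2 ≤ r := by
    by_contra hlt
    have : r = 0 ∨ r = 1 := by omega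
    rcases this with rfl | rfl
    · exact hq0 hx0
    · exact hq1 hx1
  have hsub : ∀ r, 2 ≤ r → r ≤ s → R r ⊆ R 2 := by
    intro r hr
    induction r, hr using Nat.le_induction with
    | base => exact fun _ => subset_rfl
    | succ r _ ih =>
      intro hrs
      rw [(hstep r (by omega)).2.2.2.2]
      exact Finset.sdiff_subset.trans (ih (by omega))
  rw [(hstep r hr).2.2.2.1]
  refine Finset.card_le_card fun i hi => ?_
  obtain ⟨hiR, hix⟩ := Finset.mem_filter.1 hi
  have hi2 := hsub r hr2 hr.le hiR
  rw [hR2, hR1] at hi2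
  simp only [approvers, Finset.mem_sdiff, Finset.mem_filter, not_and] at hi2
  simp only [Finset.mem_filter, Finset.mem_univ, true_and, Finset.disjoint_insert_left,
    Finset.disjoint_singleton_left]
  exact ⟨hix, hi2.1.2 hi2.1.1, hi2.2 hi2.1⟩

/-- Voters approving only `p` all count towards the weight of `p`. -/
lemma IsMajPortioning.card_le_of_singleton {P : Type*} [DecidableEq P] {tb : P → P → Prop}
    {n : ℕ} {A : Fin n → Finset P} {wt : P → ℕ} (H : IsMajPortioning tb A wt) (p : P)
    (G : Finset (Fin n)) (hG : ∀ i ∈ G, A i = {p}) : G.card ≤ wt p := by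
  obtain ⟨s, R, x, hR0, hRs, hstep, -⟩ := H
  by_contra! hlt
  have hsub : ∀ r ≤ s, G ⊆ R r := fun r => by
    induction r with
    | zero => simp [hR0]
    | succ r ih =>
      intro hr i hi
      have hGr := ih (by omega)
      obtain ⟨-, -, -, hwt, hnext⟩ := hstep r hr
      rw [hnext, Finset.mem_sdiff]
      refine ⟨hGr hi, fun happ => ?_⟩
      have hx : x r = p := by
        have := (Finset.mem_filter.1 happ).2
        rwa [hG i hi, Finset.mem_singleton] at this
      rw [hx] at hwt
      refine absurd (Finset.card_le_card (s := G) (t := approvers A (R r) p) fun u hu =>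
        Finset.mem_filter.2 ⟨hGr hu, by simp [hG u hu]⟩) (by omega)
  have := hsub s le_rfl
  rw [hRs, Finset.subset_empty] at this
  simp [this] at hlt

lemma card_filter_get_eq_countP {α : Type*} (L : List α) (p : α → Prop) [DecidablePred p] :
    (Finset.univ.filter fun i : Fin L.length => p (L.get i)).card
      = L.countP fun a => decide (p a) := by
  induction L with
  | nil => simp
  | cons a L ih =>
    rw [List.countP_cons, ← ih]
    have := Fin.card_filter_univ_succ (n := L.length) fun i => p ((a :: L).get i)
    refine this.trans ?_
    by_cases h : p a <;> simp [h]

lemma approvalsAvoiding_get {P : Type*} [DecidableEq P] (L : List (Finset P))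
    (S : Finset P) (q : P) :
    approvalsAvoiding L.get S q = L.countP fun b => decide (q ∈ b ∧ Disjoint S b) :=
  card_filter_get_eq_countP L fun b => q ∈ b ∧ Disjoint S b

/-- With `k` seats, a party of weight at most `1` gets none if `k` parties have
weight at least `2`. -/
lemma count_eq_zero_of_weight_le_one {P : Type*} [DecidableEq P] {g : ℕ → ℝ}
    (hgpos : ∀ t, 0 < g t) {k : ℕ} {wt : P → ℕ} {c : ℕ → Multiset P}
    (hc0 : c 0 = 0)
    (hc : ∀ t < k, ∃ x : P, c (t + 1) = x ::ₘ c t ∧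
      ∀ y : P, (wt y : ℝ) / g ((c t).count y) ≤ (wt x : ℝ) / g ((c t).count x))
    {p : P} (hp : wt p ≤ 1) {D : Finset P} (hk : k ≤ D.card) (hD : ∀ d ∈ D, 2 ≤ wt d) :
    (c k).count p = 0 := by
  have key : ∀ t ≤ k, (c t).card = t ∧ (c t).count p = 0 := fun t => by
    induction t with
    | zero => simp [hc0]
    | succ t ih =>
      intro ht
      obtain ⟨hcard, hcount⟩ := ih (by omega)
      obtain ⟨x, hx, hmax⟩ := hc t ht
      refine ⟨by simp [hx, hcard], ?_⟩
      have hpx : p ≠ x := by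
        rintro rfl
        obtain ⟨d, hd, hdc⟩ : ∃ d ∈ D, d ∉ (c t).toFinset := by
          by_contra! hsub
          have h1 := Finset.card_le_card (s := D) (t := (c t).toFinset) hsub
          have h2 := (c t).toFinset_card_le
          omega
        have h := hmax d
        rw [hcount, Multiset.count_eq_zero.2 (by simpa using hdc),
          div_le_div_iff_of_pos_right (hgpos 0)] at h
        have h' : wt d ≤ wt p := by exact_mod_cast h
        have := hD d hd
        omega
      rw [hx, Multiset.count_cons_of_ne hpx, hcount]
  exact (key k le_rfl).2

/-- If party `z` is beaten by `p` for its seat number `j + 1`, and all other parties have smaller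
weight than `p`, then `p` is represented in a committee of size `j + 1`. -/
lemma count_pos_of_weight {P : Type*} [DecidableEq P] {g : ℕ → ℝ}
    (hgpos : ∀ t, 0 < g t) (hgmono : ∀ a b : ℕ, a ≤ b → g a ≤ g b) {j : ℕ} {wt : P → ℕ}
    {c : ℕ → Multiset P} (hc0 : c 0 = 0)
    (hc : ∀ t < j + 1, ∃ x : P, c (t + 1) = x ::ₘ c t ∧
      ∀ y : P, (wt y : ℝ) / g ((c t).count y) ≤ (wt x : ℝ) / g ((c t).count x))
    {p z : P} (hz : (wt z : ℝ) / g j < (wt p : ℝ) / g 0)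
    (hother : ∀ q, q ≠ z → q ≠ p → wt q < wt p) :
    0 < (c (j + 1)).count p := by
  by_contra! hzero
  have hmono : ∀ t ≤ j + 1, (c t).count p ≤ (c (j + 1)).count p := fun t ht => by
    induction ht using Nat.decreasingInduction with
    | self => exact le_rfl
    | of_succ t ht ih =>
      obtain ⟨x, hx, -⟩ := hc t ht
      refine le_trans ?_ ih
      rw [hx]
      exact Multiset.count_le_count_cons _ _ _
  have hp : ∀ t ≤ j + 1, (c t).count p = 0 := fun t ht => by
    have := hmono t ht
    omega
  have hpick : ∀ t < j + 1, c (t + 1) = z ::ₘ c t ∧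
      (wt p : ℝ) / g 0 ≤ (wt z : ℝ) / g ((c t).count z) := fun t ht => by
    obtain ⟨x, hx, hmax⟩ := hc t ht
    have hle := hmax p
    rw [hp t ht.le] at hle
    by_cases hxz : x = z
    · subst hxz; exact ⟨hx, hle⟩
    have hxp : x ≠ p := by
      rintro rfl
      have := hp (t + 1) ht
      simp [hx] at this
    have hlt : (wt x : ℝ) < wt p := by exact_mod_cast hother x hxz hxp
    have h1 : (wt x : ℝ) / g ((c t).count x) ≤ (wt x : ℝ) / g 0 :=
      div_le_div_of_nonneg_left (by positivity) (hgpos 0) (hgmono _ _ (Nat.zero_le _))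
    have h2 := div_lt_div_of_pos_right hlt (hgpos 0)
    linarith
  have hcount : ∀ t ≤ j, (c t).count z = t := fun t => by
    induction t with
    | zero => simp [hc0]
    | succ t ih => intro ht; simp [(hpick t (by omega)).1, ih (by omega)]
  have := (hpick j (by omega)).2
  rw [hcount j le_rfl] at this
  linarith

/-- The ballots of all voters but the manipulator. If the manipulator reports `{c}`, the
first parties picked by majoritarian portioning are `y` and `w`, which leaves `c` with a
single voter; if they report `{z}`, the first parties picked are `z` and `c`. -/
def otherBallots {P : Type*} [DecidableEq P] (h : ℕ) (z y c w : P) (D : List P) :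
    List (Finset P) :=
  List.replicate h {c, y} ++ (List.replicate h {c, w} ++ (List.replicate h {z, y} ++
    (List.replicate h {z, w} ++ (List.replicate 2 {y} ++
      ({z} :: (D.map singleton ++ D.map singleton))))))

lemma countP_map_singleton {P : Type*} [DecidableEq P] {D : List P} (hD : D.Nodup)
    (S : Finset P) (q : P) :
    (D.map singleton : List (Finset P)).countP (fun b => decide (q ∈ b ∧ Disjoint S b))
      = if q ∈ D ∧ q ∉ S then 1 else 0 := by
  rw [List.countP_map]
  have hcount : D.count q = if q ∈ D then 1 else 0 := hD.count
  by_cases hq : q ∈ S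
  · simp only [hq, not_true, and_false, if_false, List.countP_eq_zero]
    intro d _
    simp only [Function.comp, Finset.mem_singleton, Finset.disjoint_singleton_right,
      decide_eq_true_eq]
    rintro ⟨rfl, h⟩
    exact h hq
  · simp only [hq, not_false_eq_true, and_true]
    rw [← hcount, List.count]
    refine List.countP_congr fun d _ => ?_
    simp only [Function.comp, Finset.mem_singleton, Finset.disjoint_singleton_right,
      decide_eq_true_eq, beq_iff_eq]
    constructor
    · exact fun h => h.1.symm
    · rintro rfl; exact ⟨rfl, hq⟩

lemma approvalsAvoiding_cons_otherBallots {P : Type*} [DecidableEq P] {h : ℕ} {z y c w : P}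
    {D : List P} (hD : D.Nodup) (p : P) (S : Finset P) (q : P) :
    approvalsAvoiding (({p} : Finset P) :: otherBallots h z y c w D).get S q =
      (if q = p ∧ p ∉ S then 1 else 0) +
      (if (q = c ∨ q = y) ∧ c ∉ S ∧ y ∉ S then h else 0) +
      (if (q = c ∨ q = w) ∧ c ∉ S ∧ w ∉ S then h else 0) +
      (if (q = z ∨ q = y) ∧ z ∉ S ∧ y ∉ S then h else 0) +
      (if (q = z ∨ q = w) ∧ z ∉ S ∧ w ∉ S then h else 0) +
      (if q = y ∧ y ∉ S then 2 else 0) + (if q = z ∧ z ∉ S then 1 else 0) +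
      2 * (if q ∈ D ∧ q ∉ S then 1 else 0) := by
  rw [approvalsAvoiding_get]
  simp only [otherBallots, List.countP_cons, List.countP_append, List.countP_replicate,
    countP_map_singleton hD, Finset.mem_insert, Finset.mem_singleton,
    Finset.disjoint_insert_right, Finset.disjoint_singleton_right, decide_eq_true_eq]
  ring

lemma weights_truthful {P : Type*} [DecidableEq P] {tb : P → P → Prop} {h : ℕ} (hh : 3 ≤ h)
    {z y c w : P} {D : List P} (hnd : (z :: y :: c :: w :: D).Nodup)
    (hall : ∀ q, q = z ∨ q = y ∨ q = c ∨ q = w ∨ q ∈ D) {wt : P → ℕ}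
    (H : IsMajPortioning tb (({c} : Finset P) :: otherBallots h z y c w D).get wt) :
    wt c ≤ 1 ∧ ∀ d ∈ D, 2 ≤ wt d := by
  simp only [List.nodup_cons, List.mem_cons, not_or] at hnd
  obtain ⟨⟨hzy, hzc, hzw, hzD⟩, ⟨hyc, hyw, hyD⟩, ⟨hcw, hcD⟩, hwD, hD⟩ := hnd
  have hD' : ∀ d ∈ D, d ≠ z ∧ d ≠ y ∧ d ≠ c ∧ d ≠ w := fun d hd => by
    refine ⟨?_, ?_, ?_, ?_⟩ <;> rintro rfl <;> contradiction
  have hsymm : y ≠ z ∧ c ≠ z ∧ w ≠ z ∧ c ≠ y ∧ w ≠ y ∧ w ≠ c :=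
    ⟨Ne.symm hzy, Ne.symm hzc, Ne.symm hzw, Ne.symm hyc, Ne.symm hyw, Ne.symm hcw⟩
  constructor
  · have := H.weights_of_first_two (p₀ := y) (p₁ := w) ?_ ?_ ?_ ?_
    · refine (this.2.2 c (Ne.symm hyc) hcw).trans ?_
      rw [approvalsAvoiding_cons_otherBallots hD]
      simp [*]
    · rw [approvalsAvoiding_cons_otherBallots hD]
      simp
    · rw [approvalsAvoiding_cons_otherBallots hD]
      simp [*]
      omega
    · intro q hq
      left
      simp only [approvalsAvoiding_cons_otherBallots hD]
      rcases hall q with rfl | rfl | rfl | rfl | hqD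
      · simp [*]
      · exact absurd rfl hq
      · simp [*]; omega
      · simp [*]
      · simp [*]; omega
    · intro q hq
      simp only [approvalsAvoiding_cons_otherBallots hD]
      rcases hall q with rfl | rfl | rfl | rfl | hqD
      · simp [*]; omega
      · simp [*]; omega
      · simp [*]; omega
      · exact absurd rfl hq
      · have := hD' q hqD
        simp [*]; omega
  · intro d hd
    refine le_trans ?_ (H.card_le_of_singleton d (Finset.univ.filter fun i =>
      (({c} : Finset P) :: otherBallots h z y c w D).get i = {d}) (by simp))
    rw [card_filter_get_eq_countP (({c} : Finset P) :: otherBallots h z y c w D) (· = {d})]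
    have h1 : 0 < (D.map singleton : List (Finset P)).countP fun b => decide (b = {d}) :=
      List.countP_pos_iff.2 ⟨{d}, List.mem_map.2 ⟨d, hd, rfl⟩, by simp⟩
    simp only [otherBallots, List.countP_cons, List.countP_append]
    omega

lemma weights_manipulated {P : Type*} [DecidableEq P] {tb : P → P → Prop} {h : ℕ} (hh : 3 ≤ h)
    {z y c w : P} {D : List P} (hnd : (z :: y :: c :: w :: D).Nodup)
    (hall : ∀ q, q = z ∨ q = y ∨ q = c ∨ q = w ∨ q ∈ D) (htb : ¬ tb y z) {wt : P → ℕ}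
    (H : IsMajPortioning tb (({z} : Finset P) :: otherBallots h z y c w D).get wt) :
    wt z = 2 * h + 2 ∧ wt c = 2 * h ∧ ∀ q, q ≠ z → q ≠ c → wt q ≤ 2 := by
  simp only [List.nodup_cons, List.mem_cons, not_or] at hnd
  obtain ⟨⟨hzy, hzc, hzw, hzD⟩, ⟨hyc, hyw, hyD⟩, ⟨hcw, hcD⟩, hwD, hD⟩ := hnd
  have hD' : ∀ d ∈ D, d ≠ z ∧ d ≠ y ∧ d ≠ c ∧ d ≠ w := fun d hd => by
    refine ⟨?_, ?_, ?_, ?_⟩ <;> rintro rfl <;> contradiction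
  have hsymm : y ≠ z ∧ c ≠ z ∧ w ≠ z ∧ c ≠ y ∧ w ≠ y ∧ w ≠ c :=
    ⟨Ne.symm hzy, Ne.symm hzc, Ne.symm hzw, Ne.symm hyc, Ne.symm hyw, Ne.symm hcw⟩
  have := H.weights_of_first_two (p₀ := z) (p₁ := c) ?_ ?_ ?_ ?_
  · obtain ⟨hz, hc, hq⟩ := this
    refine ⟨?_, ?_, fun q hqz hqc => (hq q hqz hqc).trans ?_⟩
    · rw [hz, approvalsAvoiding_cons_otherBallots hD]
      simp [*]; omega
    · rw [hc, approvalsAvoiding_cons_otherBallots hD]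
      simp [*]; omega
    · rw [approvalsAvoiding_cons_otherBallots hD]
      by_cases hqD : q ∈ D <;> by_cases hqy : q = y <;> simp_all
  · rw [approvalsAvoiding_cons_otherBallots hD]
    simp
  · rw [approvalsAvoiding_cons_otherBallots hD]
    simp [*]; omega
  · intro q hq
    simp only [approvalsAvoiding_cons_otherBallots hD]
    rcases hall q with rfl | rfl | rfl | rfl | hqD
    · exact absurd rfl hq
    · right
      refine ⟨?_, htb⟩
      simp [*]
    · left; simp [*]
    · left; simp [*]
    · left; have := hD' q hqD
      simp [*]; omega
  · intro q hq
    simp only [approvalsAvoiding_cons_otherBallots hD]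
    rcases hall q with rfl | rfl | rfl | rfl | hqD
    · simp [*]; omega
    · simp [*]; omega
    · exact absurd rfl hq
    · simp [*]; omega
    · have := hD' q hqD
      simp [*]; omega

/-- Let `g : ℕ → ℝ_{>0}` be a monotone divisor function such that
`(ℓ+1)/g(j) ≤ ℓ/g(0)` for some `ℓ, j ∈ ℕ` (so the divisor method based on majoritarian
portioning defined by `g` is not approval voting), and fix linear tie-breaking orders
on parties. Then there exist a committee size `k`, a number of parties `m`, and a
number of voters `n` such that this rule fails strategyproofness for unrepresented
voters: there are profiles `A, A'` and a voter `i` with `A j = A' j` for `j ≠ i`,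
`f(A, A_i) = 0` and `f(A', A_i) > 0`. -/
theorem divisorMajPort_not_av_fails_SPUnrepresented
    (g : ℕ → ℝ) (hgpos : ∀ t : ℕ, 0 < g t) (hgmono : ∀ a b : ℕ, a ≤ b → g a ≤ g b)
    (hnotAV : ∃ ℓ j : ℕ, ((ℓ : ℝ) + 1) / g j ≤ (ℓ : ℝ) / g 0)
    (tbp : ∀ m : ℕ, Fin m → Fin m → Prop)
    (htbp : ∀ m : ℕ, IsStrictTotalOrder (Fin m) (tbp m)) :
    ∃ (n m k : ℕ) (f : (Fin n → Finset (Fin m)) → Multiset (Fin m)),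
      IsDivisorMajPortRule g (tbp m) n k f ∧
      ∃ (A A' : Fin n → Finset (Fin m)) (i : Fin n),
        ValidProfile n A ∧ ValidProfile n A' ∧ (∀ j, j ≠ i → A j = A' j) ∧
        seats (f A) (A i) = 0 ∧ 0 < seats (f A') (A i) := by
  obtain ⟨ℓ, j, hℓ⟩ := hnotAV
  have hlt : ((2 * (ℓ + 3) + 2 : ℕ) : ℝ) / g j < ((2 * (ℓ + 3) : ℕ) : ℝ) / g 0 := by
    have h0 := hgpos 0
    have hj := hgpos j
    rw [div_le_div_iff₀ hj h0] at hℓ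
    rw [div_lt_div_iff₀ hj h0]
    push_cast
    have : g 0 < g j := by
      by_contra! hle
      have : (ℓ : ℝ) * g j ≤ ℓ * g 0 := by gcongr
      linarith
    linarith
  have := htbp (j + 1 + 4)
  obtain ⟨z, y, hz, hy, hzy, htb⟩ : ∃ z y : Fin (j + 1 + 4), z.val < 2 ∧ y.val < 2 ∧ z ≠ y ∧
      ¬ tbp (j + 1 + 4) y z := by
    have hne : (⟨0, by omega⟩ : Fin (j + 1 + 4)) ≠ ⟨1, by omega⟩ := by simp
    by_cases h : tbp (j + 1 + 4) ⟨1, by omega⟩ ⟨0, by omega⟩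
    · exact ⟨⟨1, by omega⟩, ⟨0, by omega⟩, by simp, by simp, hne.symm, asymm_of _ h⟩
    · exact ⟨⟨0, by omega⟩, ⟨1, by omega⟩, by simp, by simp, hne, h⟩
  let c : Fin (j + 1 + 4) := ⟨2, by omega⟩
  let w : Fin (j + 1 + 4) := ⟨3, by omega⟩
  let D : List (Fin (j + 1 + 4)) := (List.finRange (j + 1)).map fun d => d.addNat 4
  have hmemD : ∀ q, q ∈ D ↔ 4 ≤ q.val := fun q => by
    simp only [D, List.mem_map, List.mem_finRange, true_and]
    constructor
    · rintro ⟨d, rfl⟩; simp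
    · exact fun hq => ⟨⟨q.val - 4, by omega⟩, Fin.ext (by simp; omega)⟩
  have hDnd : D.Nodup :=
    (List.nodup_finRange _).map fun a b hab => by simpa using hab
  have hnd : (z :: y :: c :: w :: D).Nodup := by
    simp only [List.nodup_cons, List.mem_cons, not_or, hmemD, hDnd, and_true, Fin.ext_iff, c, w]
    rw [Ne, Fin.ext_iff] at hzy
    omega
  have hall : ∀ q, q = z ∨ q = y ∨ q = c ∨ q = w ∨ q ∈ D := fun q => by
    simp only [hmemD, Fin.ext_iff, c, w]
    rw [Ne, Fin.ext_iff] at hzy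
    omega
  let B := otherBallots (ℓ + 3) z y c w D
  have hvalid : ∀ p : Fin (j + 1 + 4), ValidProfile _ (({p} : Finset _) :: B).get := fun p i => by
    have hi := List.get_mem (({p} : Finset _) :: B) i
    generalize (({p} : Finset _) :: B).get i = b at hi
    simp only [B, otherBallots, List.mem_cons, List.mem_append, List.mem_replicate,
      List.mem_map] at hi
    rcases hi with rfl | ⟨-, rfl⟩ | ⟨-, rfl⟩ | ⟨-, rfl⟩ | ⟨-, rfl⟩ | ⟨-, rfl⟩ | rfl |
      ⟨d, -, rfl⟩ | ⟨d, -, rfl⟩ <;> simp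
  obtain ⟨f, hf⟩ :=
    exists_isDivisorMajPortRule g (tbp (j + 1 + 4)) (B.length + 1) (j + 1)
  refine ⟨B.length + 1, j + 1 + 4, j + 1, f, hf, (({c} : Finset _) :: B).get,
    (({z} : Finset _) :: B).get, 0, hvalid c, hvalid z, fun i hi => ?_, ?_, ?_⟩
  · obtain ⟨i, rfl⟩ := Fin.exists_succ_eq.2 hi
    rfl
  · obtain ⟨wt, hwt, W, hW0, hfW, hW⟩ := hf _ (hvalid c)
    obtain ⟨hc, hd⟩ := weights_truthful (by omega) hnd hall hwt
    have := count_eq_zero_of_weight_le_one hgpos hW0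
      (fun t ht => (hW t ht).imp fun x hx => ⟨hx.1, hx.2.1⟩) hc (D := D.toFinset)
      (by simp [List.toFinset_card_of_nodup hDnd, D]) (by simpa using hd)
    rw [hfW]
    simpa [seats] using this
  · obtain ⟨wt, hwt, W, hW0, hfW, hW⟩ := hf _ (hvalid z)
    obtain ⟨hz, hc, hq⟩ := weights_manipulated (by omega) hnd hall htb hwt
    have := count_pos_of_weight hgpos hgmono hW0
      (fun t ht => (hW t ht).imp fun x hx => ⟨hx.1, hx.2.1⟩) (p := c) (z := z)
      (by rw [hz, hc]; exact hlt)
      (fun q hqz hqc => by have := hq q hqz hqc; omega)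
    rw [hfW]
    simpa [seats] using this
end
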